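/- arXiv:2403.20292 — 6 statements merged into one kernel-verified Lean document; each statement's English description precedes it below -/
import Mathlib

section
/- Let {Y ∪ {Δ}, A, p} be an MDP model with state space X = Y ∪ {Δ} that satisfies Condition (S) and is uniformly absorbing for each initial state x ∈ F, where F is a nonempty finite subset of X, so that D^Π_F := {η^π_x : x ∈ F, π ∈ Π} ⊆ M(Y × A). Then the restriction of the w-topology to D^Π_F coincides with the restriction of the ws-topology to D^Π_F. -/
open MeasureTheory ProbabilityTheory Filter Topology
open scoped ENNReal

noncomputable section

/-! ### General MDP framework

The state space of an absorbing-type MDP model is `X = Y ⊕ Unit`, where `Sum.inr ()` plays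
the role of the isolated cemetery point `Δ` and `Y` is embedded via `Sum.inl`.

A history up to stage `n` is `h_n = (x_0, a_1, x_1, …, a_n, x_n)`, which we encode as the
list of pairs `(x_k, a_{k+1})`, `k < n`, together with the last state `x_n`. -/

/-- The space `H_n` of histories up to stage `n`. -/
abbrev Hist (X A : Type*) (n : ℕ) : Type _ := (Fin n → X × A) × X

/-- A strategy: for every `n`, a stochastic (Markov) kernel on `A` given `H_n`,
prescribing the law of the action `a_{n+1}` given the history `h_n`. -/
def Strategy (X A : Type*) [MeasurableSpace X] [MeasurableSpace A] : Type _ :=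
  {π : (n : ℕ) → Kernel (Hist X A n) A // ∀ n, IsMarkovKernel (π n)}

variable {X A Y : Type*} [MeasurableSpace X] [MeasurableSpace A] [MeasurableSpace Y]

/-- The finite-dimensional distributions of the strategic measure `P^π_{x0}`:
`histLaw p π x0 n` is the joint law of `(X_0, A_1, …, A_n, X_n)` under `P^π_{x0}`,
built by the Ionescu-Tulcea recursion. -/
def histLaw (p : Kernel (X × A) X) (π : Strategy X A) (x0 : X) :
    (n : ℕ) → Measure (Hist X A n)
  | 0 => Measure.dirac (fun i => i.elim0, x0)
  | n + 1 =>
      (histLaw p π x0 n).bind fun h =>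
        ((π.1 n) h).bind fun a =>
          (p (h.2, a)).map fun x' => (Fin.snoc h.1 (h.2, a), x')

/-- The law of the pair `(X_n, A_{n+1})` under the strategic measure `P^π_{x0}`. -/
def pairLaw (p : Kernel (X × A) X) (π : Strategy X A) (x0 : X) (n : ℕ) :
    Measure (X × A) :=
  (histLaw p π x0 n).bind fun h => ((π.1 n) h).map fun a => (h.2, a)

/-- The occupation measure `η^π_{x0}` on `Y × A`:
`η^π_{x0}(dx × da) = Σ_n P^π_{x0}(X_n ∈ dx ∩ Y, A_{n+1} ∈ da)`. -/
def occupation (p : Kernel ((Y ⊕ Unit) × A) (Y ⊕ Unit)) (π : Strategy (Y ⊕ Unit) A)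
    (x0 : Y ⊕ Unit) : Measure (Y × A) :=
  Measure.sum fun n => (pairLaw p π x0 n).comap fun ya : Y × A => (Sum.inl ya.1, ya.2)

/-- `P^π_{x0}(X_t ∈ Y)`.  Since the cemetery `Δ` is absorbing, this equals the tail
probability `P^π_{x0}(τ > t)` of the hitting time `τ` of `Δ`. -/
def survive (p : Kernel ((Y ⊕ Unit) × A) (Y ⊕ Unit)) (π : Strategy (Y ⊕ Unit) A)
    (x0 : Y ⊕ Unit) (t : ℕ) : ℝ≥0∞ :=
  pairLaw p π x0 t {z | ∃ y : Y, z.1 = Sum.inl y}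

/-- The model is absorbing with initial state `x0`:
`E^π_{x0}[τ] = Σ_t P^π_{x0}(τ > t) < ∞` for every strategy `π`. -/
def IsAbsorbing (p : Kernel ((Y ⊕ Unit) × A) (Y ⊕ Unit)) (x0 : Y ⊕ Unit) : Prop :=
  ∀ π : Strategy (Y ⊕ Unit) A, ∑' t : ℕ, survive p π x0 t < ⊤

/-- The model is `Λ`-uniformly absorbing with initial state `x0`:
`sup_{π ∈ Λ} E^π_{x0}[Σ_{t=n}^∞ 1{τ > t}] = sup_{π ∈ Λ} Σ_{t ≥ n} P^π_{x0}(τ > t) → 0`. -/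
def IsUnifAbsorbing (p : Kernel ((Y ⊕ Unit) × A) (Y ⊕ Unit))
    (Λ : Set (Strategy (Y ⊕ Unit) A)) (x0 : Y ⊕ Unit) : Prop :=
  Tendsto (fun n : ℕ => ⨆ π ∈ Λ, ∑' t : ℕ, survive p π x0 (n + t)) atTop (𝓝 0)

/-- The set `D^Λ_{x0} ⊆ M(Y × A)` of occupation measures of strategies in `Λ`. -/
def OccSet (p : Kernel ((Y ⊕ Unit) × A) (Y ⊕ Unit)) (Λ : Set (Strategy (Y ⊕ Unit) A))
    (x0 : Y ⊕ Unit) : Set (FiniteMeasure (Y × A)) :=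
  {η | ∃ π ∈ Λ, (η : Measure (Y × A)) = occupation p π x0}

/-- Condition (S): the action space is compact and `a ↦ ∫ g dp(·|x,a)` is continuous for
every bounded measurable `g` and every state `x`. -/
def ConditionS [TopologicalSpace A] (p : Kernel (X × A) X) : Prop :=
  CompactSpace A ∧
    ∀ g : X → ℝ, Measurable g → (∃ C, ∀ x, |g x| ≤ C) →
      ∀ x : X, Continuous fun a : A => ∫ y, g y ∂(p (x, a))

/-- Condition (W): the action space is compact and `(x,a) ↦ ∫ g dp(·|x,a)` is continuous for
every bounded continuous `g`. -/
def ConditionW [TopologicalSpace X] [TopologicalSpace A] (p : Kernel (X × A) X) : Prop :=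
  CompactSpace A ∧
    ∀ g : X → ℝ, Continuous g → (∃ C, ∀ x, |g x| ≤ C) →
      Continuous fun xa : X × A => ∫ y, g y ∂(p xa)

/-- The w-topology on `M(Ω)`: the coarsest topology making `η ↦ ∫ g dη` continuous for
every bounded continuous `g : Ω → ℝ`. -/
def wTop (Ω : Type*) [TopologicalSpace Ω] [MeasurableSpace Ω] :
    TopologicalSpace (FiniteMeasure Ω) :=
  ⨅ (g : Ω → ℝ) (_ : Continuous g) (_ : ∃ C, ∀ z, |g z| ≤ C),
    TopologicalSpace.induced (fun η : FiniteMeasure Ω => ∫ z, g z ∂(η : Measure Ω))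
      inferInstance

/-- The ws-topology on `M(Y × A)`: the coarsest topology making `η ↦ ∫ g dη` continuous for
every bounded Caratheodory function `g : Y × A → ℝ`. -/
def wsTop (Y A : Type*) [MeasurableSpace Y] [TopologicalSpace A] [MeasurableSpace A] :
    TopologicalSpace (FiniteMeasure (Y × A)) :=
  ⨅ (g : Y × A → ℝ) (_ : Measurable g) (_ : ∃ C, ∀ z, |g z| ≤ C)
    (_ : ∀ y : Y, Continuous fun a : A => g (y, a)),
    TopologicalSpace.induced (fun η : FiniteMeasure (Y × A) => ∫ z, g z ∂(η : Measure (Y × A)))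
      inferInstance

/-- The s-topology on `M(Y)`: the coarsest topology making `η ↦ ∫ f dη` continuous for
every bounded measurable `f : Y → ℝ`. -/
def sTop (Y : Type*) [MeasurableSpace Y] : TopologicalSpace (FiniteMeasure Y) :=
  ⨅ (f : Y → ℝ) (_ : Measurable f) (_ : ∃ C, ∀ z, |f z| ≤ C),
    TopologicalSpace.induced (fun η : FiniteMeasure Y => ∫ z, f z ∂(η : Measure Y))
      inferInstance



/-- The set `D^Π_F ⊆ M(Y × A)` of all occupation measures with initial states in `F`. -/
def OccSetF {Y A : Type*} [MeasurableSpace Y] [MeasurableSpace A]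
    (p : Kernel ((Y ⊕ Unit) × A) (Y ⊕ Unit)) (F : Set (Y ⊕ Unit)) :
    Set (FiniteMeasure (Y × A)) :=
  {η | ∃ x ∈ F, ∃ π : Strategy (Y ⊕ Unit) A, (η : Measure (Y × A)) = occupation p π x}


theorem lintegral_le_of_le_const {μ : Measure X} [IsProbabilityMeasure μ] {f : X → ℝ≥0∞} {c : ℝ≥0∞}
    (h : ∀ x, f x ≤ c) : ∫⁻ x, f x ∂μ ≤ c :=
  (lintegral_mono h).trans (by simp)

/-- The Bellman-type operator `u ↦ sup_a ∫ u dp(·|x,a)`. -/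
def maxStep (p : Kernel (X × A) X) (u : X → ℝ≥0∞) (x : X) : ℝ≥0∞ :=
  ⨆ a : A, ∫⁻ y, u y ∂(p (x, a))

theorem lintegral_histLaw_succ_le (p : Kernel (X × A) X) (π : Strategy X A) (x0 : X) (n : ℕ)
    (u : X → ℝ≥0∞) :
    ∫⁻ h, u h.2 ∂(histLaw p π x0 (n + 1)) ≤ ∫⁻ h, maxStep p u h.2 ∂(histLaw p π x0 n) := by
  have := π.2 n
  refine (Measure.lintegral_bind_le _ _ _).trans (lintegral_mono fun h => ?_)
  refine (Measure.lintegral_bind_le _ _ _).trans (lintegral_le_of_le_const fun a => ?_)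
  exact (lintegral_map_le _ _).trans (le_iSup (fun a => ∫⁻ y, u y ∂(p (h.2, a))) a)

theorem lintegral_histLaw_le (p : Kernel (X × A) X) (π : Strategy X A) (x0 : X) (n : ℕ)
    (u : X → ℝ≥0∞) (hu : ∀ k, Measurable ((maxStep p)^[k] u)) :
    ∫⁻ h, u h.2 ∂(histLaw p π x0 n) ≤ (maxStep p)^[n] u x0 := by
  induction n generalizing u with
  | zero =>
    have hm : Measurable fun h : Hist X A 0 => u h.2 := (hu 0).comp measurable_snd
    simp [histLaw, lintegral_dirac' _ hm]
  | succ n ih =>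
    exact (lintegral_histLaw_succ_le p π x0 n u).trans
      (ih (maxStep p u) fun k => by simpa using hu (k + 1))

theorem pairLaw_prod_univ_le (p : Kernel (X × A) X) (π : Strategy X A) (x0 : X) (n : ℕ)
    {B : Set X} (hB : MeasurableSet B)
    (hu : ∀ k, Measurable ((maxStep p)^[k] (B.indicator 1))) :
    pairLaw p π x0 n (B ×ˢ Set.univ) ≤ (maxStep p)^[n] (B.indicator 1) x0 := by
  refine le_trans ?_ (lintegral_histLaw_le p π x0 n _ hu)
  have := π.2 n
  have hBm : MeasurableSet (B ×ˢ (Set.univ : Set A)) := hB.prod .univ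
  refine (Measure.bind_apply_le _ hBm).trans (lintegral_mono fun h => ?_)
  rw [Measure.map_apply (by fun_prop) hBm]
  by_cases hh : h.2 ∈ B
  · simp [hh]
  · have : (fun a : A => (h.2, a)) ⁻¹' (B ×ˢ Set.univ) = ∅ := by
      ext a; simp [hh]
    simp [this]

theorem continuous_lintegral_of_conditionS [TopologicalSpace A] {p : Kernel (X × A) X}
    [IsMarkovKernel p] (hS : ConditionS p) {u : X → ℝ≥0∞} (hu : Measurable u) (hu1 : ∀ x, u x ≤ 1)
    (x : X) : Continuous fun a : A => ∫⁻ y, u y ∂(p (x, a)) := by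
  have h := hS.2 (fun y => (u y).toReal) hu.ennreal_toReal
    ⟨1, fun y => by simpa using ENNReal.toReal_mono ENNReal.one_ne_top (hu1 y)⟩ x
  have := ENNReal.continuous_ofReal.comp h
  refine this.congr fun a => ?_
  have hfin : ∫⁻ y, u y ∂(p (x, a)) ≠ ⊤ :=
    ((lintegral_le_of_le_const hu1).trans_lt ENNReal.one_lt_top).ne
  simp only [Function.comp]
  rw [integral_toReal hu.aemeasurable
    (.of_forall fun y => (hu1 y).trans_lt ENNReal.one_lt_top), ENNReal.ofReal_toReal hfin]

theorem measurable_maxStep [TopologicalSpace A] [SecondCountableTopology A] [Nonempty A]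
    {p : Kernel (X × A) X}
    [IsMarkovKernel p] (hS : ConditionS p) {u : X → ℝ≥0∞} (hu : Measurable u)
    (hu1 : ∀ x, u x ≤ 1) : Measurable (maxStep p u) := by
  have : maxStep p u = fun x => ⨆ n, ∫⁻ y, u y ∂(p (x, TopologicalSpace.denseSeq A n)) := by
    ext x
    refine le_antisymm (iSup_le fun a => ?_)
      (iSup_le fun n => le_iSup (fun a => ∫⁻ y, u y ∂(p (x, a))) _)
    have hcl : IsClosed {a : A | ∫⁻ y, u y ∂(p (x, a)) ≤
        ⨆ n, ∫⁻ y, u y ∂(p (x, TopologicalSpace.denseSeq A n))} :=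
      isClosed_le (continuous_lintegral_of_conditionS hS hu hu1 x) continuous_const
    have hd := (TopologicalSpace.denseRange_denseSeq A).closure_eq
    have hsub := closure_minimal (s := Set.range (TopologicalSpace.denseSeq A)) (fun a ⟨n, hn⟩ => by
      subst hn
      exact le_iSup (fun n => ∫⁻ y, u y ∂(p (x, TopologicalSpace.denseSeq A n))) n) hcl
    rw [hd] at hsub
    exact hsub (Set.mem_univ a)
  rw [this]
  exact .iSup fun n => (hu.lintegral_kernel).comp (measurable_id.prodMk measurable_const)

theorem tendsto_maxStep [TopologicalSpace A] [Nonempty A] {p : Kernel (X × A) X}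
    [IsMarkovKernel p] (hS : ConditionS p) {u : ℕ → X → ℝ≥0∞} (hu : ∀ k, Measurable (u k))
    (hu1 : ∀ k x, u k x ≤ 1) (hanti : Antitone u) (hlim : ∀ x, Tendsto (u · x) atTop (𝓝 0))
    (x : X) : Tendsto (fun k => maxStep p (u k) x) atTop (𝓝 0) := by
  have := hS.1
  have hpt (a : A) : Tendsto (fun k => ∫⁻ y, u k y ∂(p (x, a))) atTop (𝓝 0) := by
    have := tendsto_lintegral_of_dominated_convergence (μ := p (x, a)) (F := u) (f := 0) 1 hu
      (fun k => .of_forall (hu1 k)) (by simp) (.of_forall hlim)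
    simpa using this
  rw [ENNReal.tendsto_nhds_zero]
  intro ε hε
  obtain ⟨k, hk⟩ : ∃ k, {a : A | ε ≤ ∫⁻ y, u k y ∂(p (x, a))} = ∅ := by
    by_contra! hne
    have hclosed (k) : IsClosed {a : A | ε ≤ ∫⁻ y, u k y ∂(p (x, a))} :=
      isClosed_le continuous_const (continuous_lintegral_of_conditionS hS (hu k) (hu1 k) x)
    obtain ⟨a, ha⟩ := IsCompact.nonempty_iInter_of_sequence_nonempty_isCompact_isClosed
      (fun k => {a : A | ε ≤ ∫⁻ y, u k y ∂(p (x, a))})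
      (fun k a ha => le_trans ha (lintegral_mono (hanti k.le_succ))) hne (hclosed 0).isCompact
      hclosed
    obtain ⟨k, hk⟩ := ((hpt a).eventually_lt_const hε).exists
    exact hk.not_ge (Set.mem_iInter.1 ha k)
  filter_upwards [eventually_ge_atTop k] with j hj
  refine iSup_le fun a => (lintegral_mono (hanti hj)).trans ?_
  by_contra! h
  exact (Set.eq_empty_iff_forall_notMem.1 hk a) h.le

theorem maxStep_mono (p : Kernel (X × A) X) : Monotone (maxStep p) := fun _ _ h _ =>
  iSup_mono fun _ => lintegral_mono h

theorem maxStep_le_one {p : Kernel (X × A) X} [IsMarkovKernel p] {u : X → ℝ≥0∞}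
    (hu1 : ∀ x, u x ≤ 1) (x : X) : maxStep p u x ≤ 1 :=
  iSup_le fun _ => lintegral_le_of_le_const hu1

theorem measurable_iterate_maxStep [TopologicalSpace A] [SecondCountableTopology A] [Nonempty A]
    {p : Kernel (X × A) X} [IsMarkovKernel p] (hS : ConditionS p) {u : X → ℝ≥0∞}
    (hu : Measurable u) (hu1 : ∀ x, u x ≤ 1) (n : ℕ) :
    Measurable ((maxStep p)^[n] u) ∧ ∀ x, (maxStep p)^[n] u x ≤ 1 := by
  induction n with
  | zero => exact ⟨hu, hu1⟩
  | succ n ih =>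
    rw [Function.iterate_succ_apply']
    exact ⟨measurable_maxStep hS ih.1 ih.2, maxStep_le_one ih.2⟩

theorem tendsto_iterate_maxStep [TopologicalSpace A] [SecondCountableTopology A] [Nonempty A]
    {p : Kernel (X × A) X} [IsMarkovKernel p] (hS : ConditionS p) {u : ℕ → X → ℝ≥0∞}
    (hu : ∀ k, Measurable (u k)) (hu1 : ∀ k x, u k x ≤ 1) (hanti : Antitone u)
    (hlim : ∀ x, Tendsto (u · x) atTop (𝓝 0)) (n : ℕ) (x : X) :
    Tendsto (fun k => (maxStep p)^[n] (u k) x) atTop (𝓝 0) := by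
  induction n generalizing x with
  | zero => exact hlim x
  | succ n ih =>
    simp only [Function.iterate_succ_apply']
    exact tendsto_maxStep hS (fun k => (measurable_iterate_maxStep hS (hu k) (hu1 k) n).1)
      (fun k => (measurable_iterate_maxStep hS (hu k) (hu1 k) n).2)
      (fun i j hij => (maxStep_mono p).iterate n (hanti hij)) ih x

theorem measurableEmbedding_inl : MeasurableEmbedding (Sum.inl : X → X ⊕ Y) :=
  ⟨Sum.inl_injective, measurable_inl, fun _ hs => measurableSet_inl_image.2 hs⟩

theorem occupation_apply (p : Kernel ((Y ⊕ Unit) × A) (Y ⊕ Unit)) (π : Strategy (Y ⊕ Unit) A)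
    (x0 : Y ⊕ Unit) {B : Set Y} (hB : MeasurableSet B) :
    occupation p π x0 (B ×ˢ Set.univ) =
      ∑' t, pairLaw p π x0 t ((Sum.inl '' B) ×ˢ Set.univ) := by
  have he : MeasurableEmbedding fun ya : Y × A => ((Sum.inl ya.1 : Y ⊕ Unit), ya.2) :=
    measurableEmbedding_inl.prodMap .id
  rw [occupation, Measure.sum_apply _ (hB.prod .univ)]
  congr 1; ext t
  rw [he.comap_apply]
  congr 1
  ext ⟨z, a⟩
  simp only [Set.mem_image, Set.mem_prod, Prod.exists, Prod.mk.injEq, Set.mem_univ, and_true]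
  constructor
  · rintro ⟨y, b, hy, h1, -⟩
    exact ⟨y, hy, h1⟩
  · rintro ⟨y, hy, h1⟩
    exact ⟨y, a, hy, h1, rfl⟩

theorem indicator_one_le_one {α : Type*} (B : Set α) (x : α) : B.indicator (1 : α → ℝ≥0∞) x ≤ 1 :=
  Set.indicator_le_self' (by simp) x

theorem tendsto_iterate_maxStep_indicator [TopologicalSpace A] [SecondCountableTopology A]
    [Nonempty A] {p : Kernel (X × A) X} [IsMarkovKernel p] (hS : ConditionS p) {B : ℕ → Set X}
    (hB : ∀ k, MeasurableSet (B k)) (hanti : Antitone B) (hinter : ⋂ k, B k = ∅) (n : ℕ) (x : X) :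
    Tendsto (fun k => (maxStep p)^[n] ((B k).indicator 1) x) atTop (𝓝 0) := by
  refine tendsto_iterate_maxStep hS (fun k => measurable_one.indicator (hB k))
    (fun k => indicator_one_le_one (B k))
    (fun i j hij => Set.indicator_le_indicator_of_subset (hanti hij) (by simp)) (fun x => ?_) n x
  obtain ⟨k, hk⟩ : ∃ k, x ∉ B k := by
    have : x ∉ ⋂ k, B k := by simp [hinter]
    simpa using this
  refine tendsto_const_nhds.congr' ?_
  filter_upwards [eventually_ge_atTop k] with j hj
  exact (Set.indicator_of_notMem (fun h => hk (hanti hj h)) _).symm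

theorem pairLaw_inl_image_le_survive (p : Kernel ((Y ⊕ Unit) × A) (Y ⊕ Unit))
    (π : Strategy (Y ⊕ Unit) A) (x0 : Y ⊕ Unit) (t : ℕ) (B : Set Y) :
    pairLaw p π x0 t ((Sum.inl '' B) ×ˢ Set.univ) ≤ survive p π x0 t := by
  refine measure_mono ?_
  rintro ⟨z, a⟩ ⟨⟨y, -, hy⟩, -⟩
  exact ⟨y, hy.symm⟩

theorem IsUnifAbsorbing.exists_tail_le {p : Kernel ((Y ⊕ Unit) × A) (Y ⊕ Unit)} {x0 : Y ⊕ Unit}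
    (hunif : IsUnifAbsorbing p Set.univ x0) {ε : ℝ≥0∞} (hε : 0 < ε) :
    ∃ n : ℕ, ∀ π : Strategy (Y ⊕ Unit) A, ∑' t, survive p π x0 (n + t) ≤ ε := by
  obtain ⟨n, hn⟩ := ((ENNReal.tendsto_nhds_zero.1 hunif) ε hε).exists
  exact ⟨n, fun π => (iSup₂_le_iff.1 hn) π (Set.mem_univ π)⟩

/-- Under Condition (S) and uniform absorption, the state marginals of occupation measures are
uniformly continuous from above at `∅`. -/
theorem eventually_forall_occupation_le [TopologicalSpace A] [SecondCountableTopology A]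
    [Nonempty A] {p : Kernel ((Y ⊕ Unit) × A) (Y ⊕ Unit)} [IsMarkovKernel p]
    (hS : ConditionS p) {x0 : Y ⊕ Unit} (hunif : IsUnifAbsorbing p Set.univ x0) {B : ℕ → Set Y}
    (hB : ∀ k, MeasurableSet (B k)) (hanti : Antitone B) (hinter : ⋂ k, B k = ∅)
    {ε : ℝ≥0∞} (hε : 0 < ε) :
    ∀ᶠ k in atTop, ∀ π : Strategy (Y ⊕ Unit) A, occupation p π x0 (B k ×ˢ Set.univ) ≤ ε := by
  have hε2 : 0 < ε / 2 := ENNReal.half_pos hε.ne'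
  obtain ⟨n, hn⟩ := hunif.exists_tail_le hε2
  have hBm (k) : MeasurableSet (Sum.inl '' B k : Set (Y ⊕ Unit)) :=
    measurableSet_inl_image.2 (hB k)
  have hBinter : ⋂ k, (Sum.inl '' B k : Set (Y ⊕ Unit)) = ∅ := by
    rw [← Sum.inl_injective.injOn.image_iInter_eq, hinter, Set.image_empty]
  have hsum : Tendsto (fun k => ∑ t ∈ Finset.range n,
      (maxStep p)^[t] ((Sum.inl '' B k : Set (Y ⊕ Unit)).indicator 1) x0) atTop (𝓝 0) := by
    simpa using tendsto_finsetSum (Finset.range n) fun t _ =>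
      tendsto_iterate_maxStep_indicator hS hBm (fun i j hij => Set.image_mono (hanti hij))
        hBinter t x0
  refine ((ENNReal.tendsto_nhds_zero.1 hsum) (ε / 2) hε2).mono fun k hk π => ?_
  have hhead : ∑ t ∈ Finset.range n, pairLaw p π x0 t ((Sum.inl '' B k) ×ˢ Set.univ) ≤ ε / 2 :=
    (Finset.sum_le_sum fun t _ => pairLaw_prod_univ_le p π x0 t (hBm k) fun j =>
      (measurable_iterate_maxStep hS (measurable_one.indicator (hBm k))
        (indicator_one_le_one _) j).1).trans hk
  have htail : ∑' t, pairLaw p π x0 (t + n) ((Sum.inl '' B k) ×ˢ Set.univ) ≤ ε / 2 := by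
    refine le_trans (ENNReal.tsum_le_tsum fun t => ?_) (hn π)
    rw [add_comm n t]
    exact pairLaw_inl_image_le_survive p π x0 (t + n) (B k)
  calc occupation p π x0 (B k ×ˢ Set.univ)
      = ∑' t, pairLaw p π x0 t ((Sum.inl '' B k) ×ˢ Set.univ) := occupation_apply _ _ _ (hB k)
    _ = ∑ t ∈ Finset.range n, pairLaw p π x0 t ((Sum.inl '' B k) ×ˢ Set.univ) +
          ∑' t, pairLaw p π x0 (t + n) ((Sum.inl '' B k) ×ˢ Set.univ) :=
        (ENNReal.summable.sum_add_tsum_nat_add').symm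
    _ ≤ ε / 2 + ε / 2 := add_le_add hhead htail
    _ = ε := ENNReal.add_halves ε

section SetwiseLimit

variable {Ω ι : Type*} [MeasurableSpace Ω]

/-- An ultrafilter of measures that is uniformly continuous from above at `∅` converges setwise
to a measure. -/
theorem exists_measure_tendsto_setwise (l : Ultrafilter ι) (μ : ι → Measure Ω) {c : ℝ≥0∞}
    (hc : c ≠ ⊤) (hmass : Tendsto (fun i => μ i Set.univ) l (𝓝 c))
    (hcont : ∀ B : ℕ → Set Ω, (∀ k, MeasurableSet (B k)) → Antitone B → ⋂ k, B k = ∅ →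
      ∀ ε : ℝ≥0∞, 0 < ε → ∀ᶠ k in atTop, ∀ i, μ i (B k) ≤ ε) :
    ∃ ν : Measure Ω, IsFiniteMeasure ν ∧
      ∀ B, MeasurableSet B → Tendsto (fun i => μ i B) l (𝓝 (ν B)) := by
  let m : Set Ω → ℝ≥0∞ := fun B => (l.map fun i => μ i B).lim
  have hm (B : Set Ω) : Tendsto (fun i => μ i B) l (𝓝 (m B)) := (l.map fun i => μ i B).le_nhds_lim
  have hring : IsSetRing {B : Set Ω | MeasurableSet B} :=
    ⟨.empty, fun _ _ => .union, fun _ _ => .diff⟩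
  have hempty : m ∅ = 0 := tendsto_nhds_unique (hm ∅) (by simp)
  let cont : AddContent ℝ≥0∞ {B : Set Ω | MeasurableSet B} :=
    IsSetRing.addContent_of_union m hring hempty fun {s t} _ ht hd =>
      tendsto_nhds_unique (hm _)
        (((hm s).add (hm t)).congr fun i => (measure_union hd ht).symm)
  have htop (s : Set Ω) : m s ≠ ⊤ :=
    ne_top_of_le_ne_top hc (le_of_tendsto_of_tendsto' (hm s) hmass fun i =>
      measure_mono (Set.subset_univ s))
  have hsigma := addContent_iUnion_eq_sum_of_tendsto_zero hring cont (fun s _ => htop s)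
    (fun B hB hanti hinter => ENNReal.tendsto_nhds_zero.2 fun ε hε =>
      (hcont B hB hanti hinter ε hε).mono fun k hk =>
        le_of_tendsto' (hm (B k)) hk)
  let ν : Measure Ω := Measure.ofMeasurable (fun s _ => m s) hempty
    fun f hf hd => hsigma hf (MeasurableSet.iUnion hf) hd
  have hν (B : Set Ω) (hB : MeasurableSet B) : ν B = m B := Measure.ofMeasurable_apply B hB
  refine ⟨ν, ⟨?_⟩, fun B hB => ?_⟩
  · rw [hν _ .univ]
    exact (htop _).lt_top
  · rw [hν B hB]
    exact hm B

theorem exists_simpleFunc_abs_sub_le {f : Ω → ℝ} (hf : Measurable f) {C : ℝ}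
    (hC : ∀ x, |f x| ≤ C) {δ : ℝ} (hδ : 0 < δ) :
    ∃ s : SimpleFunc Ω ℝ, ∀ x, |f x - s x| ≤ δ := by
  have hmeas : Measurable fun x => δ * (⌊f x / δ⌋ : ℝ) := by fun_prop
  refine ⟨⟨fun x => δ * (⌊f x / δ⌋ : ℝ), fun y => hmeas (measurableSet_singleton y), ?_⟩,
    fun x => ?_⟩
  · refine ((Set.finite_Icc ⌊-C / δ⌋ ⌊C / δ⌋).image fun k : ℤ => δ * (k : ℝ)).subset ?_
    rintro _ ⟨x, rfl⟩
    have := abs_le.1 (hC x)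
    refine ⟨⌊f x / δ⌋, ⟨Int.floor_mono ?_, Int.floor_mono ?_⟩, rfl⟩ <;> gcongr <;> linarith
  · have h1 := Int.floor_le (f x / δ)
    have h2 := Int.lt_floor_add_one (f x / δ)
    rw [le_div_iff₀ hδ] at h1
    rw [div_lt_iff₀ hδ] at h2
    change |f x - δ * (⌊f x / δ⌋ : ℝ)| ≤ δ
    rw [abs_le]
    constructor <;> linarith

theorem integrable_of_abs_le {μ : Measure Ω} [IsFiniteMeasure μ] {f : Ω → ℝ} (hf : Measurable f)
    {C : ℝ} (hC : ∀ x, |f x| ≤ C) : Integrable f μ :=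
  .of_bound hf.aestronglyMeasurable C (.of_forall hC)

theorem abs_integral_sub_le {μ : Measure Ω} [IsFiniteMeasure μ] {f g : Ω → ℝ}
    (hf : Integrable f μ) (hg : Integrable g μ) {δ : ℝ} (h : ∀ x, |f x - g x| ≤ δ) :
    |∫ x, f x ∂μ - ∫ x, g x ∂μ| ≤ δ * μ.real Set.univ := by
  rw [← integral_sub hf hg]
  rw [← Real.norm_eq_abs]
  exact norm_integral_le_of_norm_le_const (f := fun x => f x - g x) (.of_forall h)

theorem tendsto_integral_of_tendsto_setwise {l : Filter ι} {μ : ι → Measure Ω}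
    [∀ i, IsFiniteMeasure (μ i)] {ν : Measure Ω} [IsFiniteMeasure ν]
    (h : ∀ B, MeasurableSet B → Tendsto (fun i => μ i B) l (𝓝 (ν B))) {f : Ω → ℝ}
    (hf : Measurable f) (hC : ∃ C, ∀ x, |f x| ≤ C) :
    Tendsto (fun i => ∫ x, f x ∂(μ i)) l (𝓝 (∫ x, f x ∂ν)) := by
  obtain ⟨C, hC⟩ := hC
  have hreal (B) (hB : MeasurableSet B) : Tendsto (fun i => (μ i).real B) l (𝓝 (ν.real B)) :=
    (ENNReal.tendsto_toReal (measure_ne_top ν B)).comp (h B hB)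
  have hsimple (s : SimpleFunc Ω ℝ) : Tendsto (fun i => ∫ x, s x ∂(μ i)) l (𝓝 (∫ x, s x ∂ν)) := by
    have hs (μ : Measure Ω) [IsFiniteMeasure μ] :
        ∫ x, s x ∂μ = ∑ x ∈ s.range, μ.real (s ⁻¹' {x}) • x :=
      s.integral_eq_sum (s.integrable_of_isFiniteMeasure)
    simp only [hs]
    exact tendsto_finsetSum _ fun x _ => (hreal _ (s.measurableSet_fiber x)).smul_const x
  rw [Metric.tendsto_nhds]
  intro ε hε
  set M := ν.real Set.univ with hM
  have hM0 : 0 ≤ M := measureReal_nonneg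
  obtain ⟨s, hs⟩ := exists_simpleFunc_abs_sub_le hf hC
    (show 0 < ε / (3 * (M + 1)) by positivity)
  set δ := ε / (3 * (M + 1)) with hδ
  have hδ0 : 0 < δ := by positivity
  have hδM : δ * (M + 1) = ε / 3 := by rw [hδ]; field_simp
  have hbound (μ : Measure Ω) [IsFiniteMeasure μ] :
      |∫ x, f x ∂μ - ∫ x, s x ∂μ| ≤ δ * μ.real Set.univ :=
    abs_integral_sub_le (integrable_of_abs_le hf hC) (s.integrable_of_isFiniteMeasure) hs
  filter_upwards [(Metric.tendsto_nhds.1 (hsimple s)) (ε / 3) (by positivity),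
    (hreal _ .univ).eventually_lt_const (lt_add_one M)] with i hi hmass
  rw [Real.dist_eq] at hi ⊢
  have h1 := hbound (μ i)
  have h2 := hbound ν
  have h3 : δ * (μ i).real Set.univ ≤ ε / 3 := hδM ▸ by gcongr
  have h4 : δ * ν.real Set.univ < ε / 3 := hδM ▸ by gcongr; linarith
  rw [abs_le] at h1 h2
  rw [abs_lt] at hi ⊢
  constructor <;> linarith [h1.1, h1.2, h2.1, h2.2, hi.1, hi.2]

theorem stronglyMeasurable_continuousMap {K : Type*} [TopologicalSpace K] [CompactSpace K]
    [TopologicalSpace.MetrizableSpace K] [SecondCountableTopology K] [Nonempty K] {G : Ω → C(K, ℝ)}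
    (hG : ∀ a, Measurable fun x => G x a) : StronglyMeasurable G := by
  borelize C(K, ℝ)
  have hdist (f : C(K, ℝ)) : Measurable fun x => dist (G x) f := by
    refine measurable_of_Iic fun r => ?_
    have : (fun x => dist (G x) f) ⁻¹' Set.Iic r =
        ⋂ n, {x | dist (G x (TopologicalSpace.denseSeq K n)) (f (TopologicalSpace.denseSeq K n))
          ≤ r} := by
      ext x
      simp only [Set.mem_preimage, Set.mem_Iic, Set.mem_iInter, Set.mem_ofPred_eq,
        ContinuousMap.dist_le_iff_of_nonempty]
      refine ⟨fun h n => h _, fun h a => ?_⟩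
      have hcl : IsClosed {a : K | dist (G x a) (f a) ≤ r} :=
        isClosed_le (by fun_prop) continuous_const
      have := closure_minimal (Set.range_subset_iff.2 h) hcl
      rw [(TopologicalSpace.denseRange_denseSeq K).closure_eq] at this
      exact this (Set.mem_univ a)
    rw [this]
    exact .iInter fun n => measurableSet_le ((hG _).dist measurable_const) measurable_const
  have hbasis : TopologicalSpace.IsTopologicalBasis
      {s : Set C(K, ℝ) | ∃ f r, s = Metric.ball f r} := by
    refine TopologicalSpace.isTopologicalBasis_of_isOpen_of_nhds ?_ fun f u hf hu => ?_
    · rintro _ ⟨f, r, rfl⟩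
      exact Metric.isOpen_ball
    · obtain ⟨r, hr, hru⟩ := Metric.isOpen_iff.1 hu f hf
      exact ⟨_, ⟨f, r, rfl⟩, Metric.mem_ball_self hr, hru⟩
  refine Measurable.stronglyMeasurable ?_
  rw [BorelSpace.measurable_eq (α := C(K, ℝ)), hbasis.borel_eq_generateFrom]
  refine measurable_generateFrom ?_
  rintro _ ⟨f, r, rfl⟩
  exact measurableSet_lt (hdist f) measurable_const

end SetwiseLimit

theorem tendsto_integral_caratheodory {ι : Type*}
    [TopologicalSpace Y] [BorelSpace Y] [TopologicalSpace.MetrizableSpace Y]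
    [SecondCountableTopology Y]
    [TopologicalSpace A] [BorelSpace A] [TopologicalSpace.MetrizableSpace A]
    [SecondCountableTopology A] [CompactSpace A] [Nonempty A]
    (l : Ultrafilter ι) (m : ι → Measure (Y × A)) [∀ i, IsFiniteMeasure (m i)]
    (m₀ : Measure (Y × A)) [IsFiniteMeasure m₀]
    (hw : ∀ h : Y × A → ℝ, Continuous h → (∃ C, ∀ z, |h z| ≤ C) →
      Tendsto (fun i => ∫ z, h z ∂(m i)) l (𝓝 (∫ z, h z ∂m₀)))
    (hcont : ∀ B : ℕ → Set Y, (∀ k, MeasurableSet (B k)) → Antitone B → ⋂ k, B k = ∅ →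
      ∀ ε : ℝ≥0∞, 0 < ε → ∀ᶠ k in atTop, ∀ i, m i (B k ×ˢ Set.univ) ≤ ε)
    {g : Y × A → ℝ} (hg : Measurable g) (hC : ∃ C, ∀ z, |g z| ≤ C)
    (hgc : ∀ y, Continuous fun a => g (y, a)) :
    Tendsto (fun i => ∫ z, g z ∂(m i)) l (𝓝 (∫ z, g z ∂m₀)) := by
  obtain ⟨C, hC⟩ := hC
  have hmap (μ : Measure (Y × A)) {f : Y → ℝ} (hf : Measurable f) :
      ∫ y, f y ∂(μ.map Prod.fst) = ∫ z, f z.1 ∂μ :=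
    integral_map measurable_fst.aemeasurable hf.aestronglyMeasurable
  obtain ⟨ν, hνfin, hν⟩ := exists_measure_tendsto_setwise l (fun i => (m i).map Prod.fst)
    (measure_ne_top m₀ Set.univ)
    (by
      have := hw (fun _ => 1) continuous_const ⟨1, by simp⟩
      simp only [integral_const, smul_eq_mul, mul_one] at this
      simpa [Measure.map_apply measurable_fst .univ] using ENNReal.tendsto_ofReal this)
    (fun B hB hanti hinter ε hε => (hcont B hB hanti hinter ε hε).mono fun k hk i => by
      rw [Measure.map_apply measurable_fst (hB k), ← Set.prod_univ]
      exact hk i)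
  obtain rfl : ν = m₀.map Prod.fst := by
    refine ext_of_forall_integral_eq_of_IsFiniteMeasure fun f => ?_
    have hb (y) : |f y| ≤ ‖f‖ := f.norm_coe_le_norm y
    have hfm : Measurable f := f.continuous.measurable
    refine tendsto_nhds_unique (tendsto_integral_of_tendsto_setwise hν hfm ⟨_, hb⟩) ?_
    simp only [hmap _ hfm]
    exact hw (fun z => f z.1) (by fun_prop) ⟨‖f‖, fun z => hb z.1⟩
  let G : Y → C(A, ℝ) := fun y => ⟨fun a => g (y, a), hgc y⟩
  have hGm : StronglyMeasurable G :=
    stronglyMeasurable_continuousMap fun a => hg.comp (measurable_id.prodMk measurable_const)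
  have hGb (y) : ‖G y‖ ≤ C :=
    (ContinuousMap.norm_le _ ((abs_nonneg _).trans (hC (y, Classical.arbitrary A)))).2
      fun a => hC (y, a)
  have hGi : Integrable G (m₀.map Prod.fst) :=
    .of_bound hGm.aestronglyMeasurable C (.of_forall hGb)
  rw [Metric.tendsto_nhds]
  intro ε hε
  obtain ⟨h, hhε, -⟩ := hGi.exists_boundedContinuous_integral_sub_le (show 0 < ε / 4 by positivity)
  have hhc : Continuous fun z : Y × A => h z.1 z.2 := by fun_prop
  have hhb (z : Y × A) : |h z.1 z.2| ≤ ‖h‖ :=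
    ((h z.1).norm_coe_le_norm z.2).trans (h.norm_coe_le_norm z.1)
  have hdm : Measurable fun y => ‖G y - h y‖ :=
    (hGm.sub h.continuous.stronglyMeasurable).norm.measurable
  have hdb (y) : |‖G y - h y‖| ≤ C + ‖h‖ := by
    rw [abs_norm]
    exact (norm_sub_le _ _).trans (add_le_add (hGb y) (h.norm_coe_le_norm y))
  have hdiff (μ : Measure (Y × A)) [IsFiniteMeasure μ] :
      |∫ z, g z ∂μ - ∫ z, h z.1 z.2 ∂μ| ≤ ∫ y, ‖G y - h y‖ ∂(μ.map Prod.fst) := by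
    have hgi : Integrable g μ := integrable_of_abs_le hg hC
    have hhi : Integrable (fun z => h z.1 z.2) μ := integrable_of_abs_le hhc.measurable hhb
    have hdi : Integrable (fun z : Y × A => ‖G z.1 - h z.1‖) μ :=
      integrable_of_abs_le (hdm.comp measurable_fst) fun z => hdb z.1
    rw [hmap μ hdm, ← integral_sub hgi hhi, ← Real.norm_eq_abs]
    exact norm_integral_le_of_norm_le hdi
      (.of_forall fun z => (G z.1 - h z.1).norm_coe_le_norm z.2)
  filter_upwards [Metric.tendsto_nhds.1 (hw _ hhc ⟨_, hhb⟩) (ε / 4) (by positivity),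
    (tendsto_integral_of_tendsto_setwise hν hdm ⟨_, hdb⟩).eventually_lt_const
      (hhε.trans_lt (show ε / 4 < ε / 2 by linarith))] with i hi hdi
  rw [Real.dist_eq] at hi ⊢
  have h1 := (hdiff (m i)).trans hdi.le
  have h2 := (hdiff m₀).trans hhε
  rw [abs_le] at h1 h2
  rw [abs_lt] at hi ⊢
  constructor <;> linarith [h1.1, h1.2, h2.1, h2.2, hi.1, hi.2]

theorem wTop_continuous {Ω : Type*} [TopologicalSpace Ω] [MeasurableSpace Ω] {h : Ω → ℝ}
    (hc : Continuous h) (hb : ∃ C, ∀ z, |h z| ≤ C) :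
    Continuous[wTop Ω, inferInstance] fun η : FiniteMeasure Ω => ∫ z, h z ∂(η : Measure Ω) :=
  continuous_iff_le_induced.2 (iInf_le_of_le h (iInf₂_le hc hb))

/-- Theorem 1 of the paper.  Under Condition (S), if the MDP model is
uniformly absorbing for each initial state in a nonempty finite set `F` of states, then the
w-topology and the ws-topology coincide on `D^Π_F`. -/
theorem stmt3
    {Y A : Type*}
    [TopologicalSpace Y] [MeasurableSpace Y] [BorelSpace Y]
    [TopologicalSpace.MetrizableSpace Y] [SecondCountableTopology Y] [StandardBorelSpace Y]
    [Nonempty Y]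
    [TopologicalSpace A] [MeasurableSpace A] [BorelSpace A]
    [TopologicalSpace.MetrizableSpace A] [SecondCountableTopology A] [StandardBorelSpace A]
    [Nonempty A]
    (p : Kernel ((Y ⊕ Unit) × A) (Y ⊕ Unit)) [IsMarkovKernel p]
    (hcem : ∀ a : A, p (Sum.inr (), a) {(Sum.inr () : Y ⊕ Unit)} = 1)
    (hS : ConditionS p)
    (F : Set (Y ⊕ Unit)) (hFne : F.Nonempty) (hFfin : F.Finite)
    (habs : ∀ x ∈ F, IsAbsorbing p x)
    (hunif : ∀ x ∈ F, IsUnifAbsorbing p Set.univ x) :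
    TopologicalSpace.induced (Subtype.val : OccSetF p F → FiniteMeasure (Y × A))
        (wTop (Y × A)) =
      TopologicalSpace.induced (Subtype.val : OccSetF p F → FiniteMeasure (Y × A))
        (wsTop Y A) := by
  have hA : CompactSpace A := hS.1
  refine le_antisymm ?_ (induced_mono (le_iInf fun h => le_iInf fun hc => le_iInf fun hb => ?_))
  · simp only [wsTop, induced_iInf, le_iInf_iff, induced_compose]
    intro g hg hb hgc
    let t : TopologicalSpace (OccSetF p F) := (wTop (Y × A)).induced Subtype.val
    refine continuous_iff_le_induced.1 (continuous_iff_continuousAt.2 fun η => ?_)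
    refine tendsto_iff_ultrafilter _ _ _ |>.2 fun l hl => ?_
    refine tendsto_integral_caratheodory l (fun i : OccSetF p F => (i.1 : Measure (Y × A))) _
      (fun h hc hb => ?_) (fun B hB hanti hinter ε hε => ?_) hg hb hgc
    · have hcont : Continuous fun i : OccSetF p F => ∫ z, h z ∂(i.1 : Measure (Y × A)) :=
        continuous_iff_le_induced.2 <| (induced_mono (continuous_iff_le_induced.1
          (wTop_continuous hc hb))).trans_eq induced_compose
      exact hcont.continuousAt.mono_left hl
    · filter_upwards [(Set.Finite.eventually_all hFfin).2 fun x hx =>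
        eventually_forall_occupation_le hS (hunif x hx) hB hanti hinter hε] with k hk
      rintro ⟨η, x, hx, π, hη⟩
      exact (hη ▸ hk x hx π : _)
  · exact iInf_le_of_le h (iInf_le_of_le hc.measurable (iInf₂_le hb fun y => by fun_prop))

end
end

section
/- Let {Y ∪ {Δ}, A, p} be an MDP model that satisfies Condition (S) and is absorbing with a given initial state x0, and let Λ be a nonempty set of strategies. If the set D^Λ_{x0}|_Y of marginals on Y of the occupation measures over Λ is compact in M(Y) with respect to the s-topology, then the MDP model is Λ-uniformly absorbing with the initial state x0. -/
open MeasureTheory ProbabilityTheory Filter Topology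
open scoped ENNReal

noncomputable section

variable {X A Y : Type*} [MeasurableSpace X] [MeasurableSpace A] [MeasurableSpace Y]

lemma measurable_transition (p : Kernel (X × A) X) [IsMarkovKernel p] (n : ℕ) :
    Measurable fun q : Hist X A n × A =>
      (p (q.1.2, q.2)).map fun x' =>
        ((Fin.snoc q.1.1 (q.1.2, q.2), x') : Hist X A (n + 1)) := by
  have hsnoc : Measurable fun q : Hist X A n × A =>
      (Fin.snoc q.1.1 (q.1.2, q.2) : Fin (n + 1) → X × A) := by
    refine measurable_pi_lambda _ fun i => ?_
    refine Fin.lastCases ?_ (fun j => ?_) i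
    · simp only [Fin.snoc_last]; fun_prop
    · simp only [Fin.snoc_castSucc]; fun_prop
  have hproj : Measurable fun q : Hist X A n × A => (q.1.2, q.2) := by fun_prop
  let κ : Kernel (Hist X A n × A) (Hist X A (n + 1)) :=
    Kernel.deterministic _ hsnoc ×ₖ p.comap _ hproj
  convert κ.measurable using 2 with q
  simp only [κ, Kernel.prod_apply, Kernel.deterministic_apply, Kernel.comap_apply]
  rw [Measure.dirac_prod]

/-- Integrals of functions of the current state propagate along one step of the process. -/
lemma lintegral_histLaw_succ (p : Kernel (X × A) X) [IsMarkovKernel p] (π : Strategy X A)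
    (x0 : X) (n : ℕ) {f : X → ℝ≥0∞} (hf : Measurable f) :
    ∫⁻ h, f h.2 ∂histLaw p π x0 (n + 1) =
      ∫⁻ h, ∫⁻ a, ∫⁻ x, f x ∂p (h.2, a) ∂(π.1 n) h ∂histLaw p π x0 n := by
  have := π.2 n
  have hT := measurable_transition p n
  have hsnoc (h : Hist X A n) (a : A) :
      Measurable fun x' : X => ((Fin.snoc h.1 (h.2, a), x') : Hist X A (n + 1)) := by fun_prop
  have hT' (h : Hist X A n) : Measurable fun a : A =>
      (p (h.2, a)).map fun x' => ((Fin.snoc h.1 (h.2, a), x') : Hist X A (n + 1)) :=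
    hT.comp measurable_prodMk_left
  have hbind : Measurable fun h : Hist X A n => ((π.1 n) h).bind fun a =>
      (p (h.2, a)).map fun x' => ((Fin.snoc h.1 (h.2, a), x') : Hist X A (n + 1)) := by
    refine Measure.measurable_of_measurable_coe _ fun s hs => ?_
    simp_rw [Measure.bind_apply hs (hT' _).aemeasurable]
    exact ((Measure.measurable_coe hs).comp hT).lintegral_kernel_prod_right'
  have hf' : Measurable fun h : Hist X A (n + 1) => f h.2 := hf.comp measurable_snd
  rw [histLaw, Measure.lintegral_bind hbind.aemeasurable hf'.aemeasurable]
  refine lintegral_congr fun h => ?_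
  rw [Measure.lintegral_bind (hT' h).aemeasurable hf'.aemeasurable]
  exact lintegral_congr fun a => lintegral_map hf' (hsnoc h a)

lemma lintegral_pairLaw (p : Kernel (X × A) X) (π : Strategy X A)
    (x0 : X) (n : ℕ) {f : X → ℝ≥0∞} (hf : Measurable f) :
    ∫⁻ z, f z.1 ∂pairLaw p π x0 n = ∫⁻ h, f h.2 ∂histLaw p π x0 n := by
  have := π.2 n
  have hmk (h : Hist X A n) : Measurable fun a : A => (h.2, a) := measurable_prodMk_left
  have hmeas : Measurable fun h : Hist X A n => ((π.1 n) h).map fun a => (h.2, a) := by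
    let κ : Kernel (Hist X A n) (X × A) :=
      Kernel.deterministic (fun h : Hist X A n => h.2) measurable_snd ×ₖ π.1 n
    convert κ.measurable using 2 with h
    simp only [κ, Kernel.prod_apply, Kernel.deterministic_apply]
    rw [Measure.dirac_prod]
  have hf' : Measurable fun z : X × A => f z.1 := hf.comp measurable_fst
  rw [pairLaw, Measure.lintegral_bind hmeas.aemeasurable hf'.aemeasurable]
  refine lintegral_congr fun h => ?_
  rw [lintegral_map hf' (hmk h)]
  simp

/-- The strategy following `π` before time `t` and the Markov selectors `φ` from time `t` on. -/
def Strategy.switch (π : Strategy X A) (t : ℕ) (φ : ℕ → X → A) (hφ : ∀ n, Measurable (φ n)) :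
    Strategy X A :=
  ⟨fun n => if n < t then π.1 n else
      Kernel.deterministic (fun h : Hist X A n => φ n h.2) ((hφ n).comp measurable_snd), by
    intro n
    have := π.2 n
    dsimp only
    split_ifs <;> infer_instance⟩

lemma histLaw_switch (p : Kernel (X × A) X) (π : Strategy X A) (x0 : X) (t : ℕ)
    (φ : ℕ → X → A) (hφ : ∀ n, Measurable (φ n)) {n : ℕ} (hn : n ≤ t) :
    histLaw p (π.switch t φ hφ) x0 n = histLaw p π x0 n := by
  induction n with
  | zero => rfl
  | succ n ih =>
    have hstep : (π.switch t φ hφ).1 n = π.1 n := if_pos (show n < t by lia)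
    simp only [histLaw, ih (by lia), hstep]

lemma lintegral_histLaw_switch_succ (p : Kernel (X × A) X) [IsMarkovKernel p]
    (π : Strategy X A) (x0 : X) (t : ℕ) (φ : ℕ → X → A) (hφ : ∀ n, Measurable (φ n)) {n : ℕ}
    (hn : t ≤ n) {f : X → ℝ≥0∞} (hf : Measurable f) :
    ∫⁻ h, f h.2 ∂histLaw p (π.switch t φ hφ) x0 (n + 1) =
      ∫⁻ h, ∫⁻ x, f x ∂p (h.2, φ n h.2) ∂histLaw p (π.switch t φ hφ) x0 n := by
  rw [lintegral_histLaw_succ p _ x0 n hf]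
  refine lintegral_congr fun h => ?_
  simp only [Strategy.switch, if_neg (show ¬ n < t by lia), Kernel.deterministic_apply]
  refine lintegral_dirac' _ ?_
  exact hf.lintegral_kernel.comp measurable_prodMk_left

lemma isProbabilityMeasure_histLaw (p : Kernel (X × A) X) [IsMarkovKernel p] (π : Strategy X A)
    (x0 : X) (n : ℕ) : IsProbabilityMeasure (histLaw p π x0 n) := by
  induction n with
  | zero => rw [histLaw]; infer_instance
  | succ n ih =>
    have := π.2 n
    constructor
    simpa using lintegral_histLaw_succ p π x0 n (f := fun _ => 1) measurable_const

/-- Value iteration for the terminal reward `s`, with actions restricted to the sequence `a`. -/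
def valueIter (p : Kernel (X × A) X) (a : ℕ → A) (s : X → ℝ≥0∞) : ℕ → X → ℝ≥0∞
  | 0 => s
  | n + 1 => fun x => ⨆ i, ∫⁻ y, valueIter p a s n y ∂p (x, a i)

lemma measurable_valueIter (p : Kernel (X × A) X) (a : ℕ → A) {s : X → ℝ≥0∞}
    (hs : Measurable s) (n : ℕ) : Measurable (valueIter p a s n) := by
  induction n with
  | zero => exact hs
  | succ n ih =>
    exact Measurable.iSup fun i => ih.lintegral_kernel.comp measurable_prodMk_right

lemma antitone_valueIter (p : Kernel (X × A) X) (a : ℕ → A) {s : X → ℝ≥0∞}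
    (hs : ∀ x b, ∫⁻ y, s y ∂p (x, b) ≤ s x) : Antitone (valueIter p a s) := by
  refine antitone_nat_of_succ_le fun n => ?_
  induction n with
  | zero => exact fun x => iSup_le fun i => hs x (a i)
  | succ n ih => exact fun x => iSup_mono fun i => lintegral_mono ih

lemma valueIter_le_one (p : Kernel (X × A) X) (a : ℕ → A) {s : X → ℝ≥0∞}
    (hs : ∀ x b, ∫⁻ y, s y ∂p (x, b) ≤ s x) (hs1 : ∀ x, s x ≤ 1) (n : ℕ) (x : X) :
    valueIter p a s n x ≤ 1 :=
  (antitone_valueIter p a hs n.zero_le x).trans (hs1 x)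

lemma ConditionS.continuous_lintegral [TopologicalSpace A] {p : Kernel (X × A) X}
    [IsMarkovKernel p] (hS : ConditionS p) {g : X → ℝ≥0∞} (hg : Measurable g)
    (hg1 : ∀ x, g x ≤ 1) (x : X) : Continuous fun b : A => ∫⁻ y, g y ∂p (x, b) := by
  have hbound (y : X) : |(g y).toReal| ≤ 1 := by
    rw [abs_of_nonneg ENNReal.toReal_nonneg]
    exact ENNReal.toReal_le_of_le_ofReal zero_le_one (by simpa using hg1 y)
  have hcont := ENNReal.continuous_ofReal.comp (hS.2 _ hg.ennreal_toReal ⟨1, hbound⟩ x)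
  refine hcont.congr fun b => ?_
  have hle : ∫⁻ y, g y ∂p (x, b) ≤ 1 := (lintegral_mono hg1).trans (by simp)
  simp only [Function.comp_apply]
  rw [integral_toReal hg.aemeasurable
    (ae_of_all _ fun y => (hg1 y).trans_lt ENNReal.one_lt_top),
    ENNReal.ofReal_toReal (hle.trans_lt ENNReal.one_lt_top).ne]

lemma DenseRange.le_iSup_of_continuous {B : Type*} [TopologicalSpace B] {a : ℕ → B}
    (ha : DenseRange a) {F : B → ℝ≥0∞} (hF : Continuous F) (b : B) : F b ≤ ⨆ i, F (a i) :=
  ha.induction_on (p := fun b => F b ≤ ⨆ i, F (a i)) b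
    (isClosed_le hF continuous_const) fun i => le_iSup (fun i => F (a i)) i

/-- The one-step dynamics does not decrease the expected value of the next value function. -/
lemma lintegral_valueIter_le [TopologicalSpace A] {p : Kernel (X × A) X}
    [IsMarkovKernel p] (hS : ConditionS p) {a : ℕ → A} (ha : DenseRange a) {s : X → ℝ≥0∞}
    (hsm : Measurable s) (hs : ∀ x b, ∫⁻ y, s y ∂p (x, b) ≤ s x) (hs1 : ∀ x, s x ≤ 1)
    (π : Strategy X A) (x0 : X) (n t : ℕ) :
    ∫⁻ h, valueIter p a s n h.2 ∂histLaw p π x0 (t + 1) ≤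
      ∫⁻ h, valueIter p a s (n + 1) h.2 ∂histLaw p π x0 t := by
  rw [lintegral_histLaw_succ p π x0 t (measurable_valueIter p a hsm n)]
  refine lintegral_mono fun h => ?_
  have := π.2 t
  refine (lintegral_mono fun b => ha.le_iSup_of_continuous
    (hS.continuous_lintegral (measurable_valueIter p a hsm n)
      (valueIter_le_one p a hs hs1 n) h.2) b).trans ?_
  simp [valueIter]

lemma lintegral_le_valueIter [TopologicalSpace A] {p : Kernel (X × A) X}
    [IsMarkovKernel p] (hS : ConditionS p) {a : ℕ → A} (ha : DenseRange a) {s : X → ℝ≥0∞}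
    (hsm : Measurable s) (hs : ∀ x b, ∫⁻ y, s y ∂p (x, b) ≤ s x) (hs1 : ∀ x, s x ≤ 1)
    (π : Strategy X A) (x0 : X) (n t : ℕ) :
    ∫⁻ h, s h.2 ∂histLaw p π x0 (n + t) ≤
      ∫⁻ h, valueIter p a s n h.2 ∂histLaw p π x0 t := by
  induction n generalizing t with
  | zero => rw [zero_add]; rfl
  | succ n ih =>
    rw [show n + 1 + t = n + (t + 1) by lia]
    exact (ih (t + 1)).trans (lintegral_valueIter_le hS ha hsm hs hs1 π x0 n t)

/-- Compactness of the action space makes the limit of value iteration subinvariant. -/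
lemma iInf_valueIter_le [TopologicalSpace A] {p : Kernel (X × A) X}
    [IsMarkovKernel p] (hS : ConditionS p) {a : ℕ → A} (ha : DenseRange a) {s : X → ℝ≥0∞}
    (hsm : Measurable s) (hs : ∀ x b, ∫⁻ y, s y ∂p (x, b) ≤ s x) (hs1 : ∀ x, s x ≤ 1) (x : X) :
    ⨅ n, valueIter p a s n x ≤ ⨆ i, ∫⁻ y, ⨅ n, valueIter p a s n y ∂p (x, a i) := by
  have := hS.1
  have hm := measurable_valueIter p a hsm
  have h1 := valueIter_le_one p a hs hs1
  have hanti := antitone_valueIter p a hs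
  have hcont (n : ℕ) := hS.continuous_lintegral (hm n) (h1 n) x
  let K (n : ℕ) : Set A :=
    {b | ⨅ n, valueIter p a s n x ≤ ∫⁻ y, valueIter p a s n y ∂p (x, b)}
  have hclosed (n : ℕ) : IsClosed (K n) := isClosed_le continuous_const (hcont n)
  obtain ⟨b, hb⟩ : (⋂ n, K n).Nonempty := by
    refine IsCompact.nonempty_iInter_of_sequence_nonempty_isCompact_isClosed K
      (fun n b hb => hb.trans (lintegral_mono (hanti n.le_succ))) (fun n => ?_)
      (hclosed 0).isCompact hclosed
    obtain ⟨b, -, hb⟩ := isCompact_univ.exists_isMaxOn ⟨a 0, Set.mem_univ _⟩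
      (hcont n).continuousOn
    have hle : valueIter p a s (n + 1) x ≤ ∫⁻ y, valueIter p a s n y ∂p (x, b) :=
      iSup_le fun i => hb (Set.mem_univ (a i))
    exact ⟨b, (iInf_le (valueIter p a s · x) (n + 1)).trans hle⟩
  have hfin : ∫⁻ y, valueIter p a s 0 y ∂p (x, b) ≠ ∞ :=
    ((lintegral_mono (h1 0)).trans_lt (by simp)).ne
  calc ⨅ n, valueIter p a s n x
      ≤ ⨅ n, ∫⁻ y, valueIter p a s n y ∂p (x, b) := le_iInf fun n => Set.mem_iInter.1 hb n
    _ = ∫⁻ y, ⨅ n, valueIter p a s n y ∂p (x, b) := (lintegral_iInf hm hanti hfin).symm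
    _ ≤ _ := ha.le_iSup_of_continuous (hS.continuous_lintegral (Measurable.iInf hm)
        (fun y => (iInf_le _ 0).trans (h1 0 y)) x) b

lemma exists_measurable_selector (p : Kernel (X × A) X) (a : ℕ → A) {v : X → ℝ≥0∞}
    (hv : Measurable v) (hv1 : ∀ x, v x ≤ 1)
    (hsub : ∀ x, v x ≤ ⨆ i, ∫⁻ y, v y ∂p (x, a i)) {ε : ℝ≥0∞} (hε : 0 < ε) :
    ∃ φ : X → A, Measurable φ ∧ ∀ x, v x ≤ ∫⁻ y, v y ∂p (x, φ x) + ε := by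
  classical
  have hex (x : X) : ∃ i, v x ≤ ∫⁻ y, v y ∂p (x, a i) + ε := by
    by_contra! hlt
    have hle : ⨆ i, ∫⁻ y, v y ∂p (x, a i) ≤ v x - ε :=
      iSup_le fun i => ENNReal.le_sub_of_add_le_right
        (ne_top_of_le_ne_top ((hv1 x).trans_lt ENNReal.one_lt_top).ne
          (le_add_self.trans (hlt 0).le)) (hlt i).le
    have hpos : v x ≠ 0 := (bot_lt_of_lt (hlt 0)).ne'
    exact absurd ((hsub x).trans hle) (not_le.2 (ENNReal.sub_lt_self
      ((hv1 x).trans_lt ENNReal.one_lt_top).ne hpos hε.ne'))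
  refine ⟨fun x => a (Nat.find (hex x)), ?_, fun x => Nat.find_spec (hex x)⟩
  exact Measurable.find (f := fun i _ => a i) (fun i => measurable_const)
    (fun i => measurableSet_le hv
      ((hv.lintegral_kernel.comp measurable_prodMk_right).add_const ε)) hex

/-- A subinvariant function of positive expectation at some time can be kept uniformly away from
zero in expectation, by switching to nearly optimal Markov selectors. -/
lemma exists_strategy_forall_le (p : Kernel (X × A) X) [IsMarkovKernel p] (a : ℕ → A)
    {v : X → ℝ≥0∞} (hv : Measurable v) (hv1 : ∀ x, v x ≤ 1)
    (hsub : ∀ x, v x ≤ ⨆ i, ∫⁻ y, v y ∂p (x, a i)) (π : Strategy X A) (x0 : X) (t : ℕ)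
    (hpos : ∫⁻ h, v h.2 ∂histLaw p π x0 t ≠ 0) :
    ∃ σ : Strategy X A, ∃ d : ℝ≥0∞, d ≠ 0 ∧
      ∀ n, t ≤ n → d ≤ ∫⁻ h, v h.2 ∂histLaw p σ x0 n := by
  obtain ⟨ε, hε, hsum⟩ := ENNReal.exists_pos_sum_of_countable' hpos ℕ
  choose φ hφ hφv using fun n => exists_measurable_selector p a hv hv1 hsub (hε n)
  refine ⟨π.switch t φ hφ, ∫⁻ h, v h.2 ∂histLaw p π x0 t - ∑' i, ε i,
    (tsub_pos_of_lt hsum).ne', fun n hn => ?_⟩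
  suffices h : ∫⁻ h, v h.2 ∂histLaw p π x0 t ≤
      ∫⁻ h, v h.2 ∂histLaw p (π.switch t φ hφ) x0 n + ∑ i ∈ Finset.range n, ε i from
    tsub_le_iff_right.2 (h.trans (by gcongr; exact ENNReal.sum_le_tsum _))
  induction n, hn using Nat.le_induction with
  | base => rw [histLaw_switch p π x0 t φ hφ le_rfl]; exact le_self_add
  | succ n hn ih =>
    refine ih.trans ?_
    rw [lintegral_histLaw_switch_succ p π x0 t φ hφ hn hv, Finset.sum_range_succ,
      add_comm (∑ i ∈ Finset.range n, ε i), ← add_assoc]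
    gcongr
    have := isProbabilityMeasure_histLaw p (π.switch t φ hφ) x0 n
    calc ∫⁻ h, v h.2 ∂histLaw p (π.switch t φ hφ) x0 n
        ≤ ∫⁻ h, (∫⁻ y, v y ∂p (h.2, φ n h.2) + ε n) ∂histLaw p (π.switch t φ hφ) x0 n :=
          lintegral_mono fun h => hφv n h.2
      _ = _ := by rw [lintegral_add_right _ measurable_const]; simp

/-- The indicator of the set of noncemetery states. -/
def alive : Y ⊕ Unit → ℝ≥0∞ := Sum.elim (fun _ => 1) (fun _ => 0)

lemma measurable_alive : Measurable (alive : Y ⊕ Unit → ℝ≥0∞) :=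
  measurable_const.sumElim measurable_const

lemma alive_le_one {Z : Type*} (x : Z ⊕ Unit) : alive x ≤ 1 := by
  rcases x with y | u <;> simp [alive]

lemma lintegral_alive_le {p : Kernel ((Y ⊕ Unit) × A) (Y ⊕ Unit)} [IsMarkovKernel p]
    (hcem : ∀ a : A, p (Sum.inr (), a) {(Sum.inr () : Y ⊕ Unit)} = 1) (x : Y ⊕ Unit) (b : A) :
    ∫⁻ y, alive y ∂p (x, b) ≤ alive x := by
  rcases x with y | ⟨⟩
  · exact (lintegral_mono alive_le_one).trans (by simp [alive])
  · have hset : MeasurableSet {(Sum.inr () : Y ⊕ Unit)} := by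
      rw [← Set.image_singleton]
      exact MeasurableSet.inr_image (measurableSet_singleton _)
    have hae : ∀ᵐ y ∂p (Sum.inr (), b), y = Sum.inr () :=
      mem_ae_iff.2 ((prob_compl_eq_zero_iff hset).2 (hcem b))
    rw [lintegral_congr_ae (g := fun _ => 0) (hae.mono fun y hy => by simp [hy, alive])]
    simp

lemma survive_eq_lintegral_alive (p : Kernel ((Y ⊕ Unit) × A) (Y ⊕ Unit))
    (π : Strategy (Y ⊕ Unit) A) (x0 : Y ⊕ Unit) (t : ℕ) :
    survive p π x0 t = ∫⁻ h, alive h.2 ∂histLaw p π x0 t := by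
  rw [← lintegral_pairLaw p π x0 t measurable_alive, survive]
  have hset : MeasurableSet {z : (Y ⊕ Unit) × A | ∃ y : Y, z.1 = Sum.inl y} := by
    have : {z : (Y ⊕ Unit) × A | ∃ y : Y, z.1 = Sum.inl y} =
        Prod.fst ⁻¹' Set.range (Sum.inl : Y → Y ⊕ Unit) := by
      ext z; simp [eq_comm]
    rw [this]
    exact measurable_fst measurableSet_range_inl
  rw [← lintegral_indicator_one hset]
  refine lintegral_congr fun z => ?_
  rcases z with ⟨y | u, b⟩ <;> simp [alive]

lemma lintegral_occupation_map_fst (p : Kernel ((Y ⊕ Unit) × A) (Y ⊕ Unit))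
    (π : Strategy (Y ⊕ Unit) A) (x0 : Y ⊕ Unit) {f : Y ⊕ Unit → ℝ≥0∞} (hf : Measurable f)
    (hf0 : f (Sum.inr ()) = 0) :
    ∫⁻ y, f (Sum.inl y) ∂(occupation p π x0).map Prod.fst =
      ∑' t, ∫⁻ h, f h.2 ∂histLaw p π x0 t := by
  have hemb : MeasurableEmbedding fun ya : Y × A => ((Sum.inl ya.1 : Y ⊕ Unit), ya.2) :=
    MeasurableEmbedding.prodMap
      ⟨Sum.inl_injective, measurable_inl, fun _ hs => hs.inl_image⟩ MeasurableEmbedding.id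
  rw [lintegral_map (f := fun y => f (Sum.inl y)) (hf.comp measurable_inl) measurable_fst,
    occupation, lintegral_sum_measure]
  refine tsum_congr fun t => ?_
  rw [← lintegral_pairLaw p π x0 t hf,
    ← hemb.lintegral_map (f := fun z : (Y ⊕ Unit) × A => f z.1), hemb.map_comap,
    ← lintegral_indicator hemb.measurableSet_range]
  refine lintegral_congr fun z => ?_
  rcases z with ⟨y | ⟨⟩, b⟩
  · exact Set.indicator_of_mem (Set.mem_range_self (y, b)) _
  · simp [hf0]

lemma continuous_lintegral_sTop {f : Y → ℝ≥0∞} (hf : Measurable f) (hf1 : ∀ y, f y ≤ 1) :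
    Continuous[sTop Y, inferInstance] fun ν : FiniteMeasure Y => ∫⁻ y, f y ∂(ν : Measure Y) := by
  let := sTop Y
  have hbound (y : Y) : |(f y).toReal| ≤ 1 := by
    rw [abs_of_nonneg ENNReal.toReal_nonneg]
    exact ENNReal.toReal_le_of_le_ofReal zero_le_one (by simpa using hf1 y)
  have hreal : Continuous fun ν : FiniteMeasure Y => ∫ y, (f y).toReal ∂(ν : Measure Y) :=
    continuous_iInf_dom (i := fun y => (f y).toReal) <|
      continuous_iInf_dom (i := hf.ennreal_toReal) <|
        continuous_iInf_dom (i := ⟨1, hbound⟩) continuous_induced_dom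
  refine (ENNReal.continuous_ofReal.comp hreal).congr fun ν => ?_
  have hfin : ∫⁻ y, f y ∂(ν : Measure Y) ≠ ∞ :=
    ((lintegral_mono hf1).trans_lt (by simp)).ne
  simp only [Function.comp_apply]
  rw [integral_toReal hf.aemeasurable
    (ae_of_all _ fun y => (hf1 y).trans_lt ENNReal.one_lt_top), ENNReal.ofReal_toReal hfin]

/-- Under absorption, subinvariant functions dominated by `alive` vanish along every strategy. -/
lemma IsAbsorbing.lintegral_eq_zero {p : Kernel ((Y ⊕ Unit) × A) (Y ⊕ Unit)} [IsMarkovKernel p]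
    {x0 : Y ⊕ Unit} (habs : IsAbsorbing p x0) (a : ℕ → A) {v : Y ⊕ Unit → ℝ≥0∞}
    (hv : Measurable v) (hva : ∀ x, v x ≤ alive x)
    (hsub : ∀ x, v x ≤ ⨆ i, ∫⁻ y, v y ∂p (x, a i)) (π : Strategy (Y ⊕ Unit) A) (t : ℕ) :
    ∫⁻ h, v h.2 ∂histLaw p π x0 t = 0 := by
  by_contra hpos
  obtain ⟨σ, d, hd, hle⟩ := exists_strategy_forall_le p a hv
    (fun x => (hva x).trans (alive_le_one x)) hsub π x0 t hpos
  refine (habs σ).ne (top_unique ?_)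
  calc (⊤ : ℝ≥0∞) = ∑' _ : ℕ, d := (ENNReal.tsum_const_eq_top_of_ne_zero hd).symm
    _ ≤ ∑' n, survive p σ x0 (n + t) := ENNReal.tsum_le_tsum fun n => by
        rw [survive_eq_lintegral_alive]
        exact (hle (n + t) le_add_self).trans (lintegral_mono fun h => hva h.2)
    _ ≤ ∑' n, survive p σ x0 n :=
        ENNReal.tsum_comp_le_tsum_of_injective (add_left_injective t) _

lemma IsAbsorbing.isFiniteMeasure_occupation_map_fst
    {p : Kernel ((Y ⊕ Unit) × A) (Y ⊕ Unit)} {x0 : Y ⊕ Unit} (habs : IsAbsorbing p x0)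
    (π : Strategy (Y ⊕ Unit) A) : IsFiniteMeasure ((occupation p π x0).map Prod.fst) := by
  constructor
  have h := lintegral_occupation_map_fst p π x0 measurable_alive (by simp [alive])
  simp only [← survive_eq_lintegral_alive] at h
  calc (occupation p π x0).map Prod.fst Set.univ
      = ∫⁻ y, alive (Sum.inl y : Y ⊕ Unit) ∂(occupation p π x0).map Prod.fst := by simp [alive]
    _ < ⊤ := h ▸ habs π

/-- Under Condition (S), for an absorbing MDP model with initial state `x0`,
if the set `D^Λ_{x0}|_Y` of marginals on `Y` of the occupation measures over a nonempty set of
strategies `Λ` is s-compact in `M(Y)`, then the model is `Λ`-uniformly absorbing with the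
initial state `x0`. -/
theorem stmt4
    {Y A : Type*}
    [TopologicalSpace Y] [MeasurableSpace Y] [BorelSpace Y]
    [TopologicalSpace.MetrizableSpace Y] [SecondCountableTopology Y] [StandardBorelSpace Y]
    [Nonempty Y]
    [TopologicalSpace A] [MeasurableSpace A] [BorelSpace A]
    [TopologicalSpace.MetrizableSpace A] [SecondCountableTopology A] [StandardBorelSpace A]
    [Nonempty A]
    (p : Kernel ((Y ⊕ Unit) × A) (Y ⊕ Unit)) [IsMarkovKernel p]
    (hcem : ∀ a : A, p (Sum.inr (), a) {(Sum.inr () : Y ⊕ Unit)} = 1)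
    (x0 : Y ⊕ Unit)
    (habs : IsAbsorbing p x0)
    (hS : ConditionS p)
    (Λ : Set (Strategy (Y ⊕ Unit) A)) (hΛ : Λ.Nonempty)
    (hcomp : @IsCompact _ (sTop Y)
      {ν : FiniteMeasure Y | ∃ π ∈ Λ,
        (ν : Measure Y) = (occupation p π x0).map Prod.fst}) :
    IsUnifAbsorbing p Λ x0 := by
  have := hS.1
  let a : ℕ → A := TopologicalSpace.denseSeq A
  have ha : DenseRange a := TopologicalSpace.denseRange_denseSeq A
  have hsub := lintegral_alive_le hcem
  let V : ℕ → Y ⊕ Unit → ℝ≥0∞ := valueIter p a alive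
  have hm : ∀ n, Measurable (V n) := measurable_valueIter p a measurable_alive
  have hanti : Antitone V := antitone_valueIter p a hsub
  have hV1 : ∀ n x, V n x ≤ 1 := valueIter_le_one p a hsub alive_le_one
  have hV0 (n : ℕ) : V n (Sum.inr ()) = 0 := le_zero_iff.1 (hanti n.zero_le (Sum.inr ()))
  let G (n : ℕ) (ν : FiniteMeasure Y) : ℝ≥0∞ := ∫⁻ y, V n (Sum.inl y) ∂(ν : Measure Y)
  have hGanti (ν : FiniteMeasure Y) : Antitone fun n => G n ν :=
    fun m n hmn => lintegral_mono fun y => hanti hmn (Sum.inl y)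
  have hGcont (n : ℕ) : Continuous[sTop Y, inferInstance] (G n) :=
    continuous_lintegral_sTop ((hm n).comp measurable_inl) fun y => hV1 n _
  set K : Set (FiniteMeasure Y) :=
    {ν | ∃ π ∈ Λ, (ν : Measure Y) = (occupation p π x0).map Prod.fst}
  have hG0 (ν : FiniteMeasure Y) (hν : ν ∈ K) : ⨅ n, G n ν = 0 := by
    obtain ⟨π, -, hπ⟩ := hν
    have hfin : ∫⁻ y, V 0 (Sum.inl y) ∂(ν : Measure Y) ≠ ∞ :=
      ((lintegral_mono fun y => hV1 0 _).trans_lt (by simp)).ne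
    rw [← lintegral_iInf (f := fun n y => V n (Sum.inl y))
      (fun n => (hm n).comp measurable_inl) (fun m n hmn y => hanti hmn (Sum.inl y)) hfin, hπ,
      lintegral_occupation_map_fst p π x0 (f := fun x => ⨅ n, V n x) (Measurable.iInf hm)
        (by simp [hV0])]
    refine ENNReal.tsum_eq_zero.2 fun t => ?_
    exact habs.lintegral_eq_zero a (Measurable.iInf hm) (fun x => iInf_le _ 0)
      (iInf_valueIter_le hS ha measurable_alive hsub alive_le_one) π t
  have htail (π : Strategy (Y ⊕ Unit) A) (hπ : π ∈ Λ) (n : ℕ) :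
      ∃ ν ∈ K, ∑' t, survive p π x0 (n + t) ≤ G n ν := by
    refine ⟨⟨_, habs.isFiniteMeasure_occupation_map_fst π⟩, ⟨π, hπ, rfl⟩, ?_⟩
    refine le_of_le_of_eq (ENNReal.tsum_le_tsum fun t => ?_)
      (lintegral_occupation_map_fst p π x0 (hm n) (hV0 n)).symm
    rw [survive_eq_lintegral_alive]
    exact lintegral_le_valueIter hS ha measurable_alive hsub alive_le_one π x0 n t
  rw [IsUnifAbsorbing, ENNReal.tendsto_atTop_zero]
  intro ε hε
  obtain ⟨N, hN⟩ : ∃ N, ∀ ν ∈ K, G N ν < ε := by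
    let := sTop Y
    obtain ⟨N, hN⟩ := hcomp.elim_directed_cover (fun n => {ν | G n ν < ε})
      (fun n => isOpen_lt (hGcont n) continuous_const)
      (fun ν hν => Set.mem_iUnion.2 (iInf_lt_iff.1 ((hG0 ν hν).trans_lt hε)))
      (directed_of_isDirected_le fun m n hmn ν hν => (hGanti ν hmn).trans_lt hν)
    exact ⟨N, fun ν hν => hN hν⟩
  refine ⟨N, fun n hn => iSup₂_le fun π hπ => ?_⟩
  obtain ⟨ν, hν, hle⟩ := htail π hπ n
  exact hle.trans ((hGanti ν hn).trans (hN ν hν).le)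

end
end

section
/- Consider the MDP model {Y ∪ {Δ}, A, p} with Y = {1/n : n ≥ 1} ∪ {0} endowed with the relative Euclidean topology (a compact set), A = {a*} a singleton, and p({Δ}|x,a) = 1 for all x and a. This model satisfies Condition (S) and is uniformly absorbing for every initial state; the set of occupation measures over all initial states in Y is D^Π_Y = {δ_{1/n}(dy) ⊗ δ_{a*}(da) : n ≥ 1} ∪ {δ_0(dy) ⊗ δ_{a*}(da)}; and as n → ∞, δ_{1/n} ⊗ δ_{a*} converges to δ_0 ⊗ δ_{a*} in the w-topology but not in the ws-topology, so the w-topology and ws-topology on D^Π_Y do not coincide. -/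
open MeasureTheory ProbabilityTheory Filter Topology
open scoped ENNReal

noncomputable section

variable {X A Y : Type*} [MeasurableSpace X] [MeasurableSpace A] [MeasurableSpace Y]

/-! ### The concrete example of Remark 2:
`Y = {1/n : n ≥ 1} ∪ {0} ⊆ ℝ` (relative Euclidean topology), `A = {a*}` a singleton,
and `p({Δ}|x,a) ≡ 1`. -/

/-- The set `{1/n : n ≥ 1} ∪ {0} ⊆ ℝ`. -/
def S6 : Set ℝ := insert 0 {x : ℝ | ∃ n : ℕ, x = 1 / (n + 1)}

/-- The state `1/(n+1) ∈ Y`. -/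
def pt6 (n : ℕ) : ↥S6 := ⟨1 / (n + 1), Set.mem_insert_iff.mpr (Or.inr ⟨n, rfl⟩)⟩

/-- The state `0 ∈ Y`. -/
def zero6 : ↥S6 := ⟨0, Set.mem_insert _ _⟩

theorem eq_dirac_of_apply_singleton_eq_one {α : Type*} [MeasurableSpace α] {μ : Measure α}
    [IsProbabilityMeasure μ] {a : α} (hm : MeasurableSet {a}) (h : μ {a} = 1) : μ = Measure.dirac a := by
  have hae : ∀ᵐ x ∂μ, x ∈ ({a} : Set α) := (prob_compl_eq_zero_iff hm).2 h
  ext s hs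
  rw [Measure.dirac_apply' a hs]
  by_cases ha : a ∈ s
  · rw [Set.indicator_of_mem ha, Pi.one_apply]
    refine prob_compl_eq_zero_iff hs |>.1 ?_
    filter_upwards [hae] with x hx
    rw [Set.mem_singleton_iff.1 hx]
    exact ha
  · rw [Set.indicator_of_notMem ha]
    refine measure_eq_zero_iff_ae_notMem.2 ?_
    filter_upwards [hae] with x hx
    rw [Set.mem_singleton_iff.1 hx]
    exact ha

theorem Strategy.apply_unit_eq_dirac (π : Strategy X Unit) (n : ℕ) (h : Hist X Unit n) :
    π.1 n h = Measure.dirac () := by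
  have := π.2 n
  refine eq_dirac_of_apply_singleton_eq_one (measurableSet_singleton _) ?_
  rw [Set.eq_univ_of_forall (s := {()}) (fun x => by simp), measure_univ]

theorem measurable_snoc_unit (n : ℕ) :
    Measurable fun h : Hist X Unit n =>
      (Fin.snoc (α := fun _ => X × Unit) h.1 (h.2, ()) : Fin (n + 1) → X × Unit) := by
  refine measurable_pi_iff.2 fun i => ?_
  induction i using Fin.lastCases with
  | last => simp only [Fin.snoc_last]; fun_prop
  | cast i => simp only [Fin.snoc_castSucc]; fun_prop

theorem histLaw_succ_of_dirac {p : Kernel (X × Unit) X} {d : X}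
    (hp : ∀ z, p z = Measure.dirac d) (π : Strategy X Unit) (x : X) {n : ℕ} {h : Hist X Unit n}
    (hh : histLaw p π x n = Measure.dirac h) :
    histLaw p π x (n + 1) = Measure.dirac (Fin.snoc h.1 (h.2, ()), d) := by
  have hstep : ∀ h : Hist X Unit n,
      (((π.1 n) h).bind fun a => (p (h.2, a)).map fun x' =>
        ((Fin.snoc h.1 (h.2, a), x') : Hist X Unit (n + 1))) =
      Measure.dirac (Fin.snoc h.1 (h.2, ()), d) := by
    intro h
    rw [π.apply_unit_eq_dirac, Measure.dirac_bind (measurable_of_countable _), hp,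
      Measure.map_dirac' (by fun_prop)]
  rw [histLaw, hh]
  simp only [hstep]
  rw [Measure.dirac_bind]
  exact Measure.measurable_dirac.comp ((measurable_snoc_unit n).prodMk measurable_const)

theorem exists_histLaw_eq_dirac {p : Kernel (X × Unit) X} {d : X}
    (hp : ∀ z, p z = Measure.dirac d) (π : Strategy X Unit) (x : X) (n : ℕ) :
    ∃ h : Hist X Unit n, histLaw p π x n = Measure.dirac h ∧ h.2 = if n = 0 then x else d := by
  induction n with
  | zero => exact ⟨_, rfl, by simp⟩
  | succ n ih =>
    obtain ⟨h, hh, -⟩ := ih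
    exact ⟨_, histLaw_succ_of_dirac hp π x hh, by simp⟩

theorem pairLaw_eq_dirac {p : Kernel (X × Unit) X} {d : X}
    (hp : ∀ z, p z = Measure.dirac d) (π : Strategy X Unit) (x : X) (n : ℕ) :
    pairLaw p π x n = Measure.dirac (if n = 0 then x else d, ()) := by
  obtain ⟨h, hh, hx⟩ := exists_histLaw_eq_dirac hp π x n
  have hstep : ∀ h : Hist X Unit n,
      ((π.1 n) h).map (fun a => (h.2, a)) = Measure.dirac (h.2, ()) := by
    intro h
    rw [π.apply_unit_eq_dirac, Measure.map_dirac' (by fun_prop)]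
  rw [pairLaw, hh]
  simp only [hstep]
  rw [Measure.dirac_bind, hx]
  exact Measure.measurable_dirac.comp (by fun_prop)

theorem survive_eq_zero {p : Kernel ((Y ⊕ Unit) × Unit) (Y ⊕ Unit)}
    (hp : ∀ z, p z = Measure.dirac (Sum.inr ())) (π : Strategy (Y ⊕ Unit) Unit)
    (x : Y ⊕ Unit) {t : ℕ} (ht : t ≠ 0) : survive p π x t = 0 := by
  have hs : MeasurableSet {z : (Y ⊕ Unit) × Unit | ∃ y : Y, z.1 = Sum.inl y} := by
    convert measurable_fst (measurableSet_range_inl (α := Y) (β := Unit)) using 1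
    ext z
    simp [eq_comm]
  rw [survive, pairLaw_eq_dirac hp, Measure.dirac_apply' _ hs]
  simp [ht]

theorem isAbsorbing_of_dirac {p : Kernel ((Y ⊕ Unit) × Unit) (Y ⊕ Unit)}
    (hp : ∀ z, p z = Measure.dirac (Sum.inr ())) (x : Y ⊕ Unit) : IsAbsorbing p x := by
  intro π
  rw [tsum_eq_single 0 fun t ht => survive_eq_zero hp π x ht, survive, pairLaw_eq_dirac hp]
  exact measure_lt_top _ _

theorem isUnifAbsorbing_of_dirac {p : Kernel ((Y ⊕ Unit) × Unit) (Y ⊕ Unit)}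
    (hp : ∀ z, p z = Measure.dirac (Sum.inr ())) (Λ : Set (Strategy (Y ⊕ Unit) Unit))
    (x : Y ⊕ Unit) : IsUnifAbsorbing p Λ x := by
  refine tendsto_const_nhds.congr' ?_
  filter_upwards [eventually_ge_atTop 1] with n hn
  have h0 : ∀ (π : Strategy (Y ⊕ Unit) Unit) (t : ℕ), survive p π x (n + t) = 0 :=
    fun π t => survive_eq_zero hp π x (by omega)
  simp [h0]

theorem occupation_inl_eq_dirac {p : Kernel ((Y ⊕ Unit) × Unit) (Y ⊕ Unit)}
    (hp : ∀ z, p z = Measure.dirac (Sum.inr ())) (π : Strategy (Y ⊕ Unit) Unit) (x : Y) :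
    occupation p π (Sum.inl x) = (Measure.dirac x).prod (Measure.dirac ()) := by
  have hemb : MeasurableEmbedding
      (fun ya : Y × Unit => ((Sum.inl ya.1, ya.2) : (Y ⊕ Unit) × Unit)) :=
    (MeasurableEmbedding.mk Sum.inl_injective measurable_inl fun _ hs => hs.inl_image).prodMap
      MeasurableEmbedding.id
  rw [Measure.dirac_prod_dirac]
  ext s hs
  rw [occupation, Measure.sum_apply _ hs, tsum_eq_single 0]
  · rw [hemb.comap_apply, pairLaw_eq_dirac hp, Measure.dirac_apply' _ (hemb.measurableSet_image.2 hs),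
      Measure.dirac_apply' _ hs]
    exact Set.indicator_image hemb.injective (f := 1) (x := (x, ()))
  · intro n hn
    rw [hemb.comap_apply, pairLaw_eq_dirac hp, Measure.dirac_apply' _ (hemb.measurableSet_image.2 hs)]
    simp [hn]

theorem tendsto_nhds_wTop_iff {ι Ω : Type*} [TopologicalSpace Ω] [MeasurableSpace Ω]
    {l : Filter ι} {μs : ι → FiniteMeasure Ω} {μ : FiniteMeasure Ω} :
    Tendsto μs l (@nhds _ (wTop Ω) μ) ↔
      ∀ g : Ω → ℝ, Continuous g → (∃ C, ∀ z, |g z| ≤ C) →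
        Tendsto (fun i => ∫ z, g z ∂(μs i : Measure Ω)) l (𝓝 (∫ z, g z ∂(μ : Measure Ω))) := by
  unfold wTop
  rw [nhds_iInf, tendsto_iInf]
  refine forall_congr' fun g => ?_
  rw [nhds_iInf, tendsto_iInf]
  refine forall_congr' fun _ => ?_
  rw [nhds_iInf, tendsto_iInf]
  refine forall_congr' fun _ => ?_
  rw [nhds_induced, tendsto_comap_iff, Function.comp_def]

theorem tendsto_nhds_wsTop_iff {ι : Type*} [TopologicalSpace A]
    {l : Filter ι} {μs : ι → FiniteMeasure (Y × A)} {μ : FiniteMeasure (Y × A)} :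
    Tendsto μs l (@nhds _ (wsTop Y A) μ) ↔
      ∀ g : Y × A → ℝ, Measurable g → (∃ C, ∀ z, |g z| ≤ C) →
        (∀ y : Y, Continuous fun a : A => g (y, a)) →
        Tendsto (fun i => ∫ z, g z ∂(μs i : Measure (Y × A))) l
          (𝓝 (∫ z, g z ∂(μ : Measure (Y × A)))) := by
  unfold wsTop
  rw [nhds_iInf, tendsto_iInf]
  refine forall_congr' fun g => ?_
  rw [nhds_iInf, tendsto_iInf]
  refine forall_congr' fun _ => ?_
  rw [nhds_iInf, tendsto_iInf]
  refine forall_congr' fun _ => ?_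
  rw [nhds_iInf, tendsto_iInf]
  refine forall_congr' fun _ => ?_
  rw [nhds_induced, tendsto_comap_iff, Function.comp_def]

theorem tendsto_pt6 : Tendsto pt6 atTop (𝓝 zero6) :=
  tendsto_subtype_rng.2 tendsto_one_div_add_atTop_nhds_zero_nat

theorem pt6_ne_zero6 (n : ℕ) : pt6 n ≠ zero6 := fun h =>
  (Nat.one_div_pos_of_nat (α := ℝ) (n := n)).ne' (congrArg Subtype.val h)

theorem tendsto_wTop_dirac_pt6 {μs : ℕ → FiniteMeasure (↥S6 × Unit)}
    {μ : FiniteMeasure (↥S6 × Unit)}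
    (hs : ∀ n, (μs n : Measure (↥S6 × Unit)) = (Measure.dirac (pt6 n)).prod (Measure.dirac ()))
    (hμ : (μ : Measure (↥S6 × Unit)) = (Measure.dirac zero6).prod (Measure.dirac ())) :
    Tendsto μs atTop (@nhds _ (wTop (↥S6 × Unit)) μ) := by
  refine tendsto_nhds_wTop_iff.2 fun g hg _ => ?_
  simp only [hs, hμ, Measure.dirac_prod_dirac, integral_dirac]
  exact (hg.tendsto _).comp (tendsto_pt6.prodMk_nhds tendsto_const_nhds)

theorem not_tendsto_wsTop_dirac_pt6 {μs : ℕ → FiniteMeasure (↥S6 × Unit)}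
    {μ : FiniteMeasure (↥S6 × Unit)}
    (hs : ∀ n, (μs n : Measure (↥S6 × Unit)) = (Measure.dirac (pt6 n)).prod (Measure.dirac ()))
    (hμ : (μ : Measure (↥S6 × Unit)) = (Measure.dirac zero6).prod (Measure.dirac ())) :
    ¬ Tendsto μs atTop (@nhds _ (wsTop ↥S6 Unit) μ) := by
  intro h
  have h1 := tendsto_nhds_wsTop_iff.1 h (Set.indicator {(zero6, ())} 1)
    (measurable_one.indicator (measurableSet_singleton _))
    ⟨1, fun z => by by_cases hz : z = (zero6, ()) <;> simp [hz]⟩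
    fun y => continuous_of_discreteTopology
  simp only [hs, hμ, Measure.dirac_prod_dirac, integral_dirac] at h1
  simp [pt6_ne_zero6] at h1

/-- Remark 2 of the paper.  The MDP model with compact countable state set
`Y = {1/n : n ≥ 1} ∪ {0}`, a singleton action space and `p({Δ}|x,a) ≡ 1` satisfies
Condition (S) and is uniformly absorbing for every initial state; its occupation measures over
all initial states in `Y` are exactly the measures `δ_{1/n} ⊗ δ_{a*}` and `δ_0 ⊗ δ_{a*}`;
and `δ_{1/n} ⊗ δ_{a*} → δ_0 ⊗ δ_{a*}` in the w-topology but not in the ws-topology, so the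
w-topology and the ws-topology on `D^Π_Y` do not coincide. -/
theorem stmt6
    (p : Kernel ((↥S6 ⊕ Unit) × Unit) (↥S6 ⊕ Unit)) [IsMarkovKernel p]
    (hp : ∀ (x : ↥S6 ⊕ Unit) (a : Unit), p (x, a) {(Sum.inr () : ↥S6 ⊕ Unit)} = 1) :
    ConditionS p ∧
      (∀ x : ↥S6 ⊕ Unit, IsAbsorbing p x ∧ IsUnifAbsorbing p Set.univ x) ∧
      {η : FiniteMeasure (↥S6 × Unit) | ∃ x : ↥S6, ∃ π : Strategy (↥S6 ⊕ Unit) Unit,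
          (η : Measure (↥S6 × Unit)) = occupation p π (Sum.inl x)} =
        {η : FiniteMeasure (↥S6 × Unit) | (∃ n : ℕ,
            (η : Measure (↥S6 × Unit)) = (Measure.dirac (pt6 n)).prod (Measure.dirac ())) ∨
          (η : Measure (↥S6 × Unit)) = (Measure.dirac zero6).prod (Measure.dirac ())} ∧
      (∀ (μs : ℕ → FiniteMeasure (↥S6 × Unit)) (μl : FiniteMeasure (↥S6 × Unit)),
        (∀ n, (μs n : Measure (↥S6 × Unit)) = (Measure.dirac (pt6 n)).prod (Measure.dirac ())) →
        (μl : Measure (↥S6 × Unit)) = (Measure.dirac zero6).prod (Measure.dirac ()) →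
        Tendsto μs atTop (@nhds _ (wTop (↥S6 × Unit)) μl) ∧
          ¬ Tendsto μs atTop (@nhds _ (wsTop ↥S6 Unit) μl)) ∧
      TopologicalSpace.induced
          (Subtype.val : {η : FiniteMeasure (↥S6 × Unit) | ∃ x : ↥S6,
              ∃ π : Strategy (↥S6 ⊕ Unit) Unit,
              (η : Measure (↥S6 × Unit)) = occupation p π (Sum.inl x)} →
            FiniteMeasure (↥S6 × Unit)) (wTop (↥S6 × Unit)) ≠
        TopologicalSpace.induced
          (Subtype.val : {η : FiniteMeasure (↥S6 × Unit) | ∃ x : ↥S6,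
              ∃ π : Strategy (↥S6 ⊕ Unit) Unit,
              (η : Measure (↥S6 × Unit)) = occupation p π (Sum.inl x)} →
            FiniteMeasure (↥S6 × Unit)) (wsTop ↥S6 Unit) := by
  have hd : ∀ z, p z = Measure.dirac (Sum.inr ()) := fun z =>
    eq_dirac_of_apply_singleton_eq_one
      (by simpa using (measurableSet_singleton ()).inr_image (α := ↥S6)) (hp z.1 z.2)
  let π₀ : Strategy (↥S6 ⊕ Unit) Unit := ⟨fun _ => Kernel.const _ (Measure.dirac ()),
    fun _ => inferInstance⟩
  refine ⟨⟨inferInstance, fun _ _ _ _ => continuous_of_discreteTopology⟩,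
    fun x => ⟨isAbsorbing_of_dirac hd x, isUnifAbsorbing_of_dirac hd _ x⟩, ?_,
    fun μs μl hs hl => ⟨tendsto_wTop_dirac_pt6 hs hl, not_tendsto_wsTop_dirac_pt6 hs hl⟩, ?_⟩
  · ext η
    simp only [Set.mem_ofPred_eq, occupation_inl_eq_dirac hd]
    constructor
    · rintro ⟨⟨x, rfl | ⟨n, rfl⟩⟩, -, h⟩
      · exact Or.inr h
      · exact Or.inl ⟨n, h⟩
    · rintro (⟨n, h⟩ | h)
      · exact ⟨_, π₀, h⟩
      · exact ⟨_, π₀, h⟩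
  · intro heq
    let ν (x : ↥S6) : FiniteMeasure (↥S6 × Unit) :=
      ⟨(Measure.dirac x).prod (Measure.dirac ()), inferInstance⟩
    let ν' (x : ↥S6) : {η : FiniteMeasure (↥S6 × Unit) | ∃ x : ↥S6,
        ∃ π : Strategy (↥S6 ⊕ Unit) Unit,
        (η : Measure (↥S6 × Unit)) = occupation p π (Sum.inl x)} :=
      ⟨ν x, x, π₀, (occupation_inl_eq_dirac hd π₀ x).symm⟩
    have hw : Tendsto (fun n => ν (pt6 n)) atTop (@nhds _ (wTop (↥S6 × Unit)) (ν zero6)) :=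
      tendsto_wTop_dirac_pt6 (fun _ => rfl) rfl
    have hws : ¬ Tendsto (fun n => ν (pt6 n)) atTop (@nhds _ (wsTop ↥S6 Unit) (ν zero6)) :=
      not_tendsto_wsTop_dirac_pt6 (fun _ => rfl) rfl
    have hnhds := congrArg (fun T => @nhds _ T (ν' zero6)) heq
    simp only [nhds_induced] at hnhds
    have hw' : Tendsto (fun n => ν' (pt6 n)) atTop
        (comap Subtype.val (@nhds _ (wTop (↥S6 × Unit)) (ν zero6))) := tendsto_comap_iff.2 hw
    rw [hnhds] at hw'
    exact hws (tendsto_comap_iff.1 hw')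

end
end

section
/- For the MDP model E1 with initial state x0 = (0,0), there is a sequence {η_m}_{m≥1} ⊆ D^Π_{x0} that converges to some η ∈ D^Π_{x0} in the w-topology but does not have any subsequence that converges in M(Y × A) with respect to the ws-topology. -/
open MeasureTheory ProbabilityTheory Filter Topology
open scoped ENNReal

noncomputable section

variable {X A Y : Type*} [MeasurableSpace X] [MeasurableSpace A] [MeasurableSpace Y]

/-! ### The MDP model E1 (Example 1 of the paper):
`Y = {0,1} × [0,1]` (`{0,1}` discrete — here `Bool` — and `[0,1]` Euclidean),
`A = [0,1]`, transitions `p({1} × dy | (0,x), a) = δ_a(dy)`, `p({Δ}|(1,x),a) = 1`,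
`p({Δ}|Δ,a) = 1`, initial state `x₀ = (0,0)`. -/

/-- The space `Y = {0,1} × [0,1]` of the model E1. -/
abbrev Y1 : Type := Bool × ↥(Set.Icc (0:ℝ) 1)

/-- The action space `A = [0,1]` of the model E1. -/
abbrev A1 : Type := ↥(Set.Icc (0:ℝ) 1)

/-- The state space `X = Y ∪ {Δ}` of the model E1. -/
abbrev X1 : Type := Y1 ⊕ Unit

/-- `0` as an element of `[0,1]`. -/
def c0 : ↥(Set.Icc (0:ℝ) 1) := ⟨0, ⟨le_rfl, zero_le_one⟩⟩

/-- The initial state `x₀ = (0,0)` of the model E1. -/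
def x01 : X1 := Sum.inl (false, c0)

/-- A probability measure that charges a single point fully is the Dirac mass at that point. -/
lemma eq_dirac_of_singleton_eq_one {Ω : Type*} [MeasurableSpace Ω] [MeasurableSingletonClass Ω]
    (μ : Measure Ω) [IsProbabilityMeasure μ] {x : Ω} (hx : μ {x} = 1) :
    μ = Measure.dirac x := by
  have hae : (id : Ω → Ω) =ᵐ[μ] fun _ => x :=
    (prob_compl_eq_zero_iff (measurableSet_singleton x)).2 hx
  calc μ = μ.map id := Measure.map_id.symm
    _ = μ.map fun _ => x := Measure.map_congr hae
    _ = Measure.dirac x := by simp [Measure.map_const]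

/-- When points are measurable, binding a Dirac mass needs no measurability of the integrand. -/
lemma dirac_bind_of_measurableSingletonClass {Ω Ω' : Type*} [MeasurableSpace Ω]
    [MeasurableSingletonClass Ω] [MeasurableSpace Ω'] (x : Ω) (f : Ω → Measure Ω') :
    (Measure.dirac x).bind f = f x := by
  rw [Measure.bind_congr_right (ae_eq_dirac f)]
  exact Measure.dirac_bind measurable_const x

instance {Ω Ω' : Type*} [MeasurableSpace Ω] [MeasurableSpace Ω'] [MeasurableSingletonClass Ω]
    [MeasurableSingletonClass Ω'] : MeasurableSingletonClass (Ω ⊕ Ω') where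
  measurableSet_singleton z := by
    rcases z with z | z
    · rw [← Set.image_singleton]
      exact measurableSet_inl_image.2 (measurableSet_singleton z)
    · rw [← Set.image_singleton]
      exact measurableSet_inr_image.2 (measurableSet_singleton z)

/-- The strategy that always plays the action `a`. -/
def constStrategy (X : Type*) {A : Type*} [MeasurableSpace X] [MeasurableSpace A] (a : A) :
    Strategy X A :=
  ⟨fun _ => Kernel.const _ (Measure.dirac a), fun _ => inferInstance⟩

section DeterministicDynamics

variable [MeasurableSingletonClass X] [MeasurableSingletonClass A]

/-- If the action `a` moves every state `x` to `T x`, then playing `a` forever yields a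
deterministic history whose last state is the corresponding iterate of `T`. -/
lemma exists_histLaw_constStrategy_eq_dirac (p : Kernel (X × A) X) (a : A) (T : X → X)
    (hT : ∀ x, p (x, a) = Measure.dirac (T x)) (x0 : X) (n : ℕ) :
    ∃ h : Hist X A n, h.2 = T^[n] x0 ∧
      histLaw p (constStrategy X a) x0 n = Measure.dirac h := by
  induction n with
  | zero => exact ⟨(fun i => i.elim0, x0), rfl, rfl⟩
  | succ n ih =>
    obtain ⟨h, hlast, hh⟩ := ih
    refine ⟨(Fin.snoc h.1 (h.2, a), T h.2), ?_, ?_⟩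
    · rw [Function.iterate_succ_apply', hlast]
    · rw [histLaw, hh, dirac_bind_of_measurableSingletonClass]
      simp only [constStrategy, Kernel.const_apply]
      rw [dirac_bind_of_measurableSingletonClass, hT]
      exact Measure.map_dirac' (by fun_prop) _

lemma pairLaw_constStrategy_eq_dirac (p : Kernel (X × A) X) (a : A) (T : X → X)
    (hT : ∀ x, p (x, a) = Measure.dirac (T x)) (x0 : X) (n : ℕ) :
    pairLaw p (constStrategy X a) x0 n = Measure.dirac (T^[n] x0, a) := by
  obtain ⟨h, hlast, hh⟩ := exists_histLaw_constStrategy_eq_dirac p a T hT x0 n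
  rw [pairLaw, hh, dirac_bind_of_measurableSingletonClass, ← hlast]
  exact Measure.map_dirac' (by fun_prop) _

end DeterministicDynamics

lemma measurableEmbedding_inl_prod :
    MeasurableEmbedding fun ya : Y × A => ((Sum.inl ya.1 : Y ⊕ Unit), ya.2) :=
  MeasurableEmbedding.prodMap
    ⟨Sum.inl_injective, measurable_inl, fun _ hs => measurableSet_inl_image.2 hs⟩
    MeasurableEmbedding.id

lemma comap_dirac_inl (y : Y) (a : A) :
    (Measure.dirac ((Sum.inl y : Y ⊕ Unit), a)).comap
      (fun ya : Y × A => ((Sum.inl ya.1 : Y ⊕ Unit), ya.2)) = Measure.dirac (y, a) := by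
  rw [← measurableEmbedding_inl_prod.comap_map (Measure.dirac (y, a)),
    Measure.map_dirac' measurableEmbedding_inl_prod.measurable]

lemma comap_dirac_inr (a : A) :
    (Measure.dirac ((Sum.inr () : Y ⊕ Unit), a)).comap
      (fun ya : Y × A => ((Sum.inl ya.1 : Y ⊕ Unit), ya.2)) = 0 := by
  rw [← Measure.measure_univ_eq_zero, measurableEmbedding_inl_prod.comap_apply,
    Measure.dirac_apply' _
      (measurableEmbedding_inl_prod.measurableSet_image.2 MeasurableSet.univ)]
  simp

/-- The dynamics of the model E1 under the constant action `a`. -/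
def stepE1 (a : A1) : X1 → X1
  | Sum.inl (false, _) => Sum.inl (true, a)
  | _ => Sum.inr ()

/-- The occupation measure of the constant action `a` in the model E1. -/
def occE1 (a : A1) : FiniteMeasure (Y1 × A1) :=
  ⟨Measure.dirac ((false, c0), a) + Measure.dirac ((true, a), a), inferInstance⟩

lemma occupation_constStrategy_E1 (p : Kernel (X1 × A1) X1) (a : A1)
    (hstep : ∀ x, p (x, a) = Measure.dirac (stepE1 a x)) :
    occupation p (constStrategy X1 a) x01 = occE1 a := by
  have hend : ∀ n, (stepE1 a)^[n + 2] x01 = Sum.inr () := by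
    intro n
    induction n with
    | zero => rfl
    | succ n ih => rw [Function.iterate_succ_apply', ih]; rfl
  ext s hs
  rw [occupation, Measure.sum_apply _ hs]
  simp only [pairLaw_constStrategy_eq_dirac p a _ hstep]
  rw [tsum_eq_sum (s := Finset.range 2)]
  · rw [Finset.sum_range_succ, Finset.sum_range_one]
    change ((Measure.dirac ((Sum.inl (false, c0) : X1), a)).comap _) s +
      ((Measure.dirac ((Sum.inl (true, a) : X1), a)).comap _) s = _
    rw [comap_dirac_inl, comap_dirac_inl]
    rfl
  · intro n hn
    obtain ⟨k, rfl⟩ : ∃ k, n = k + 2 := ⟨n - 2, by simp at hn; omega⟩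
    rw [hend, comap_dirac_inr]
    rfl

lemma integral_occE1 (a : A1) (g : Y1 × A1 → ℝ) :
    ∫ z, g z ∂(occE1 a : Measure (Y1 × A1)) = g ((false, c0), a) + g ((true, a), a) := by
  change ∫ z, g z ∂(Measure.dirac ((false, c0), a) + Measure.dirac ((true, a), a)) = _
  rw [integral_add_measure (integrable_dirac (by simp)) (integrable_dirac (by simp)),
    integral_dirac, integral_dirac]

lemma tendsto_wTop_iff {Ω ι : Type*} [TopologicalSpace Ω] [MeasurableSpace Ω] {l : Filter ι}
    {u : ι → FiniteMeasure Ω} {η : FiniteMeasure Ω} :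
    Tendsto u l (@nhds _ (wTop Ω) η) ↔
      ∀ g : Ω → ℝ, Continuous g → (∃ C, ∀ z, |g z| ≤ C) →
        Tendsto (fun i => ∫ z, g z ∂(u i : Measure Ω)) l (𝓝 (∫ z, g z ∂(η : Measure Ω))) := by
  unfold wTop
  simp only [nhds_iInf, tendsto_iInf, nhds_induced, tendsto_comap_iff, Function.comp_def]

lemma tendsto_wsTop_iff {ι : Type*} [TopologicalSpace A] {l : Filter ι}
    {u : ι → FiniteMeasure (Y × A)} {η : FiniteMeasure (Y × A)} :
    Tendsto u l (@nhds _ (wsTop Y A) η) ↔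
      ∀ g : Y × A → ℝ, Measurable g → (∃ C, ∀ z, |g z| ≤ C) →
        (∀ y, Continuous fun a => g (y, a)) →
        Tendsto (fun i => ∫ z, g z ∂(u i : Measure (Y × A))) l
          (𝓝 (∫ z, g z ∂(η : Measure (Y × A)))) := by
  unfold wsTop
  simp only [nhds_iInf, tendsto_iInf, nhds_induced, tendsto_comap_iff, Function.comp_def]

lemma tendsto_occE1_wTop {a : ℕ → A1} {b : A1} (hab : Tendsto a atTop (𝓝 b)) :
    Tendsto (fun m => occE1 (a m)) atTop (@nhds _ (wTop (Y1 × A1)) (occE1 b)) := by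
  refine tendsto_wTop_iff.2 fun g hg _ => ?_
  simp only [integral_occE1]
  have hcont : Continuous fun c : A1 => g ((false, c0), c) + g ((true, c), c) := by fun_prop
  exact (hcont.tendsto b).comp hab

/-- Along pairwise distinct actions, the occupation measures do not converge in the
ws-topology: the indicator of the even-indexed second states separates two subsequences. -/
lemma not_tendsto_occE1_wsTop {a : ℕ → A1} (ha : Function.Injective a)
    (L : FiniteMeasure (Y1 × A1)) :
    ¬ Tendsto (fun k => occE1 (a k)) atTop (@nhds _ (wsTop Y1 A1) L) := by
  intro h
  set S : Set Y1 := Set.range fun k => (true, a (2 * k)) with hS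
  have hSm : MeasurableSet S := (Set.countable_range _).measurableSet
  set g : Y1 × A1 → ℝ := fun z => S.indicator 1 z.1 with hg
  have hlim := tendsto_wsTop_iff.1 h g ((measurable_one.indicator hSm).comp measurable_fst)
    ⟨1, fun z => by
      by_cases hz : z.1 ∈ S <;> simp [hg, hz]⟩
    (fun y => by simpa only [hg] using continuous_const)
  simp only [integral_occE1] at hlim
  have hfalse : (false, c0) ∉ S := by simp [hS]
  have heven : ∀ k, (true, a (2 * k)) ∈ S := fun k => ⟨k, rfl⟩
  have hodd : ∀ k, (true, a (2 * k + 1)) ∉ S := by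
    rintro k ⟨j, hj⟩
    have := ha (Prod.mk.inj hj).2
    omega
  have htwo : Tendsto (fun k : ℕ => 2 * k) atTop atTop :=
    tendsto_atTop_mono (fun k => by simp only [id]; omega) tendsto_id
  have hsucc : Tendsto (fun k : ℕ => 2 * k + 1) atTop atTop :=
    tendsto_atTop_mono (fun k => by simp only [id]; omega) tendsto_id
  have h1 := hlim.comp htwo
  have h0 := hlim.comp hsucc
  simp only [hg, Function.comp_def, Set.indicator_of_notMem hfalse,
    Set.indicator_of_mem (heven _), Set.indicator_of_notMem (hodd _), Pi.one_apply] at h1 h0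
  have e1 := tendsto_nhds_unique h1 tendsto_const_nhds
  have e0 := tendsto_nhds_unique h0 tendsto_const_nhds
  linarith

/-- The action `1 / (m + 1)`. -/
def actionSeq (m : ℕ) : A1 :=
  ⟨1 / ((m : ℝ) + 1), by positivity, by
    rw [div_le_one (by positivity)]; linarith [(m.cast_nonneg : (0 : ℝ) ≤ m)]⟩

lemma tendsto_actionSeq : Tendsto actionSeq atTop (𝓝 c0) :=
  tendsto_subtype_rng.2 tendsto_one_div_add_atTop_nhds_zero_nat

lemma injective_actionSeq : Function.Injective actionSeq := by
  intro m n h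
  simpa [actionSeq] using h

/-- Proposition 2(c) of the paper.  For the model E1 with initial state
`x₀ = (0,0)`, there is a sequence in `D^Π_{x₀}` converging to an element of `D^Π_{x₀}` in the
w-topology which has no subsequence converging in `M(Y × A)` in the ws-topology. -/
theorem stmt8
    (p : Kernel (X1 × A1) X1) [IsMarkovKernel p]
    (h0 : ∀ (x : ↥(Set.Icc (0:ℝ) 1)) (a : A1),
      p (Sum.inl (false, x), a) = Measure.dirac (Sum.inl (true, a) : X1))
    (h1 : ∀ (x : ↥(Set.Icc (0:ℝ) 1)) (a : A1),
      p (Sum.inl (true, x), a) {(Sum.inr () : X1)} = 1)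
    (hcem : ∀ a : A1, p ((Sum.inr () : X1), a) {(Sum.inr () : X1)} = 1) :
    ∃ (ηs : ℕ → FiniteMeasure (Y1 × A1)) (ηl : FiniteMeasure (Y1 × A1)),
      (∀ m, ηs m ∈ OccSet p Set.univ x01) ∧
      ηl ∈ OccSet p Set.univ x01 ∧
      Tendsto ηs atTop (@nhds _ (wTop (Y1 × A1)) ηl) ∧
      ∀ (φ : ℕ → ℕ), StrictMono φ → ∀ L : FiniteMeasure (Y1 × A1),
        ¬ Tendsto (fun k => ηs (φ k)) atTop (@nhds _ (wsTop Y1 A1) L) := by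
  have hstep : ∀ (a : A1) (x : X1), p (x, a) = Measure.dirac (stepE1 a x) := by
    rintro a (⟨_ | _, x⟩ | ⟨⟩)
    · exact h0 x a
    · exact eq_dirac_of_singleton_eq_one _ (h1 x a)
    · exact eq_dirac_of_singleton_eq_one _ (hcem a)
  have hocc : ∀ a, occE1 a ∈ OccSet p Set.univ x01 := fun a =>
    ⟨constStrategy X1 a, Set.mem_univ _, (occupation_constStrategy_E1 p a (hstep a)).symm⟩
  exact ⟨fun m => occE1 (actionSeq m), occE1 c0, fun m => hocc _, hocc _,
    tendsto_occE1_wTop tendsto_actionSeq, fun φ hφ L =>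
      not_tendsto_occE1_wsTop (injective_actionSeq.comp hφ.injective) L⟩

end
end

section
/- Let Y = {0,1} × [0,1] ({0,1} discrete, [0,1] Euclidean, product topology) and A = [0,1] Euclidean, and fix a Borel probability measure μ on [0,1]. For each m ≥ 1 define the finite Borel measure η_m on Y × A by ∫ g dη_m = m∫_0^{1/m} g((0,0),a) da + m∫_0^{1/m} (∫_A g((1,x),a) μ(da)) dx for every bounded measurable g, and define η_∞ := δ_{((0,0),0)} + δ_{(1,0)} ⊗ μ. Then for every bounded continuous function g on Y × A, ∫ g dη_m → ∫ g dη_∞ as m → ∞; that is, η_m converges to η_∞ in the w-topology on M(Y × A). -/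
open MeasureTheory ProbabilityTheory Filter Topology
open scoped ENNReal

noncomputable section

variable {X A Y : Type*} [MeasurableSpace X] [MeasurableSpace A] [MeasurableSpace Y]

/-- `η_m` is characterised by:  for every bounded measurable `g`,
`∫ g dη_m = m∫₀^{1/m} g((0,0),t) dt + m∫₀^{1/m} (∫_A g((1,x),a) μ(da)) dx`
(for `t ∈ [0,1/m] ⊆ [0,1]`, `Set.projIcc 0 1 _ t = t`). -/
def IsEtaM (μ : Measure A1) (m : ℕ) (η : Measure (Y1 × A1)) : Prop :=
  ∀ g : Y1 × A1 → ℝ, Measurable g → (∃ C, ∀ z, |g z| ≤ C) →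
    ∫ z, g z ∂η =
      m * (∫ t in Set.Icc (0:ℝ) (1/m), g (((false, c0) : Y1), Set.projIcc 0 1 zero_le_one t)) +
      m * (∫ t in Set.Icc (0:ℝ) (1/m),
            ∫ a, g (((true, Set.projIcc 0 1 zero_le_one t) : Y1), a) ∂μ)

/-- `η_∞ = δ_{((0,0),0)} + δ_{(1,0)} ⊗ μ`. -/
def etaInf (μ : Measure A1) : Measure (Y1 × A1) :=
  Measure.dirac (((false, c0) : Y1), c0) + (Measure.dirac ((true, c0) : Y1)).prod μ

/-- The averages of a continuous function over `[0, 1/(m+1)]` converge to its value at `0`. -/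
theorem tendsto_average_Icc_zero {f : ℝ → ℝ} (hf : Continuous f) :
    Tendsto (fun m : ℕ => ((m + 1 : ℕ) : ℝ) * ∫ t in Set.Icc (0:ℝ) (1 / ((m + 1 : ℕ) : ℝ)), f t)
      atTop (𝓝 (f 0)) := by
  have hd : HasDerivAt (fun u => ∫ t in (0:ℝ)..u, f t) (f 0) 0 :=
    intervalIntegral.integral_hasDerivAt_right (hf.intervalIntegrable _ _)
      hf.stronglyMeasurable.stronglyMeasurableAtFilter hf.continuousAt
  rw [hasDerivAt_iff_tendsto_slope_zero] at hd
  have hu : Tendsto (fun m : ℕ => 1 / ((m + 1 : ℕ) : ℝ)) atTop (𝓝[≠] 0) := by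
    refine tendsto_nhdsWithin_iff.2 ⟨?_, Eventually.of_forall fun m => ?_⟩
    · simpa using tendsto_one_div_add_atTop_nhds_zero_nat (𝕜 := ℝ)
    · simp only [Set.mem_compl_iff, Set.mem_singleton_iff]
      positivity
  refine (hd.comp hu).congr fun m => ?_
  have h0 : (0:ℝ) ≤ 1 / ((m + 1 : ℕ) : ℝ) := by positivity
  simp only [Function.comp_apply, zero_add, intervalIntegral.integral_same, sub_zero, smul_eq_mul]
  rw [intervalIntegral.integral_of_le h0, integral_Icc_eq_integral_Ioc, one_div, inv_inv]

theorem integral_etaInf (μ : Measure A1) [IsProbabilityMeasure μ] {g : Y1 × A1 → ℝ}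
    (hg : Continuous g) {C : ℝ} (hC : ∀ z, |g z| ≤ C) :
    ∫ z, g z ∂(etaInf μ) = g ((false, c0), c0) + ∫ a, g ((true, c0), a) ∂μ := by
  have hint (ν : Measure (Y1 × A1)) [IsFiniteMeasure ν] : Integrable g ν :=
    Integrable.of_bound hg.aestronglyMeasurable C (Eventually.of_forall hC)
  rw [etaInf, integral_add_measure (hint _) (hint _), integral_dirac, integral_prod _ (hint _),
    integral_dirac]

theorem tendsto_integral_of_isEtaM (μ : Measure A1) [IsProbabilityMeasure μ]
    {ηm : ℕ → Measure (Y1 × A1)} (hηm : ∀ m : ℕ, 1 ≤ m → IsEtaM μ m (ηm m))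
    {g : Y1 × A1 → ℝ} (hg : Continuous g) (hb : ∃ C, ∀ z, |g z| ≤ C) :
    Tendsto (fun m : ℕ => ∫ z, g z ∂(ηm (m + 1))) atTop (𝓝 (∫ z, g z ∂(etaInf μ))) := by
  obtain ⟨C, hC⟩ := hb
  have hp : Set.projIcc (0:ℝ) 1 zero_le_one 0 = c0 := Set.projIcc_left _
  have hproj : Continuous (Set.projIcc (0:ℝ) 1 zero_le_one) := continuous_projIcc
  have h₁ : Continuous fun t : ℝ =>
      g (((false, c0) : Y1), Set.projIcc 0 1 zero_le_one t) := by fun_prop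
  have h₂ : Continuous fun t : ℝ =>
      ∫ a, g (((true, Set.projIcc 0 1 zero_le_one t) : Y1), a) ∂μ := by
    refine continuous_of_dominated (bound := fun _ => C) (fun t => ?_)
      (fun t => Eventually.of_forall fun a => hC _) (integrable_const _)
      (Eventually.of_forall fun a => by fun_prop)
    exact Continuous.aestronglyMeasurable (by fun_prop)
  have h := (tendsto_average_Icc_zero h₁).add (tendsto_average_Icc_zero h₂)
  rw [hp] at h
  rw [integral_etaInf μ hg hC]
  exact h.congr fun m => (hηm (m + 1) (by omega) g hg.measurable ⟨C, hC⟩).symm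

/-- For every Borel probability measure `μ` on `[0,1]` and the measures
`η_m` (`m ≥ 1`) and `η_∞ = δ_{((0,0),0)} + δ_{(1,0)} ⊗ μ` as above, `∫ g dη_m → ∫ g dη_∞` for
every bounded continuous `g` on `Y × A`; that is, `η_m → η_∞` in the w-topology on `M(Y × A)`. -/
theorem stmt9
    (μ : Measure A1) [IsProbabilityMeasure μ]
    (ηm : ℕ → Measure (Y1 × A1)) (hηm : ∀ m : ℕ, 1 ≤ m → IsEtaM μ m (ηm m)) :
    (∀ g : Y1 × A1 → ℝ, Continuous g → (∃ C, ∀ z, |g z| ≤ C) →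
      Tendsto (fun m : ℕ => ∫ z, g z ∂(ηm (m + 1))) atTop
        (𝓝 (∫ z, g z ∂(etaInf μ)))) ∧
    ∀ (F : ℕ → FiniteMeasure (Y1 × A1)) (Fl : FiniteMeasure (Y1 × A1)),
      (∀ m, (F m : Measure (Y1 × A1)) = ηm (m + 1)) →
      (Fl : Measure (Y1 × A1)) = etaInf μ →
      Tendsto F atTop (@nhds _ (wTop (Y1 × A1)) Fl) := by
  refine ⟨fun g hg hb => tendsto_integral_of_isEtaM μ hηm hg hb, fun F Fl hF hFl => ?_⟩
  rw [wTop]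
  simp only [nhds_iInf, tendsto_iInf, nhds_induced, tendsto_comap_iff]
  intro g hg hb
  simpa only [Function.comp_def, hF, hFl] using tendsto_integral_of_isEtaM μ hηm hg hb

end
end

section
/- Let Y = {0,1} × [0,1] ({0,1} discrete, [0,1] Euclidean, product topology) and A = [0,1] Euclidean, fix a Borel probability measure μ on [0,1], and let η_m (m ≥ 1) and η_∞ be as follows: ∫ g dη_m = m∫_0^{1/m} g((0,0),a) da + m∫_0^{1/m} (∫_A g((1,x),a) μ(da)) dx for bounded measurable g, and η_∞ := δ_{((0,0),0)} + δ_{(1,0)} ⊗ μ. Define g₀((n,x),a) := 1{x > 0} for (n,x) ∈ Y, a ∈ A. Then g₀ is a bounded Caratheodory function on Y × A with ∫ g₀ dη_m = 1 for every m ≥ 1 and ∫ g₀ dη_∞ = 0; consequently, the sequence {η_m}_{m≥1} has no subsequence converging in M(Y × A) with respect to the ws-topology. -/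
open MeasureTheory ProbabilityTheory Filter Topology
open scoped ENNReal

noncomputable section

variable {X A Y : Type*} [MeasurableSpace X] [MeasurableSpace A] [MeasurableSpace Y]

/-- The function `g₀((n,x),a) = 1{x > 0}`. -/
def g0 : Y1 × A1 → ℝ := fun z => if 0 < (z.1.2 : ℝ) then 1 else 0

/-- Convergence in the ws-topology implies convergence of the integrals of every bounded
Caratheodory function. -/
lemma tendsto_integral_of_tendsto_wsTop {ι Y A : Type*} [MeasurableSpace Y] [TopologicalSpace A]
    [MeasurableSpace A] {l : Filter ι} {F : ι → FiniteMeasure (Y × A)} {L : FiniteMeasure (Y × A)}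
    (h : Tendsto F l (@nhds _ (wsTop Y A) L)) {g : Y × A → ℝ} (hg : Measurable g)
    (hb : ∃ C, ∀ z, |g z| ≤ C) (hc : ∀ y : Y, Continuous fun a : A => g (y, a)) :
    Tendsto (fun i => ∫ z, g z ∂(F i : Measure (Y × A))) l
      (𝓝 (∫ z, g z ∂(L : Measure (Y × A)))) := by
  have hle : wsTop Y A ≤ TopologicalSpace.induced
      (fun η : FiniteMeasure (Y × A) => ∫ z, g z ∂(η : Measure (Y × A))) inferInstance :=
    iInf_le_of_le g <| iInf_le_of_le hg <| iInf_le_of_le hb <| iInf_le _ hc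
  have h' := h.mono_right (nhds_mono hle)
  rw [nhds_induced] at h'
  exact tendsto_comap.comp h'

/-- A bounded measurable function vanishing on `{(0,0)} × A` and equal to `1` on
`{1} × (0,1/m] × A` has `η_m`-integral `1`. -/
lemma IsEtaM.integral_eq_one {μ : Measure A1} [IsProbabilityMeasure μ] {m : ℕ} (hm : 1 ≤ m)
    {η : Measure (Y1 × A1)} (hη : IsEtaM μ m η) {g : Y1 × A1 → ℝ} (hg : Measurable g)
    (hb : ∃ C, ∀ z, |g z| ≤ C) (hzero : ∀ a, g ((false, c0), a) = 0)
    (hone : ∀ (x : A1) a, 0 < (x : ℝ) → (x : ℝ) ≤ 1 / m → g ((true, x), a) = 1) :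
    ∫ z, g z ∂η = 1 := by
  have hm0 : (0 : ℝ) < m := by exact_mod_cast hm
  have hm1 : 1 / (m : ℝ) ≤ 1 := by
    rw [div_le_one hm0]
    exact_mod_cast hm
  rw [hη g hg hb, integral_Icc_eq_integral_Ioc
    (f := fun t => ∫ a, g (((true, Set.projIcc 0 1 zero_le_one t) : Y1), a) ∂μ)]
  have hIoc : ∫ t in Set.Ioc (0 : ℝ) (1 / m),
      ∫ a, g (((true, Set.projIcc 0 1 zero_le_one t) : Y1), a) ∂μ
        = ∫ _ in Set.Ioc (0 : ℝ) (1 / m), (1 : ℝ) := by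
    refine setIntegral_congr_fun measurableSet_Ioc fun t ht => ?_
    have hproj : (Set.projIcc 0 1 zero_le_one t : A1) = ⟨t, ht.1.le, ht.2.trans hm1⟩ :=
      Set.projIcc_of_mem zero_le_one _
    simp only [hproj, hone ⟨t, ht.1.le, ht.2.trans hm1⟩ _ ht.1 ht.2]
    simp
  rw [hIoc]
  simp [hzero, hm0.le, hm0.ne']

lemma measurable_g0 : Measurable g0 :=
  Measurable.ite (measurableSet_lt measurable_const (by fun_prop)) measurable_const
    measurable_const

lemma abs_g0_le_one (z : Y1 × A1) : |g0 z| ≤ 1 := by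
  unfold g0
  split_ifs <;> simp

lemma integral_g0_etaInf (μ : Measure A1) [SFinite μ] : ∫ z, g0 z ∂(etaInf μ) = 0 := by
  refine integral_eq_zero_of_ae ?_
  have hs : MeasurableSet {z : Y1 × A1 | g0 z = 0} :=
    measurable_g0 (measurableSet_singleton 0)
  refine ae_add_measure_iff.2 ⟨?_, ?_⟩
  · refine (ae_dirac_iff hs).2 ?_
    simp [g0, c0]
  · rw [Measure.dirac_prod]
    refine (ae_map_iff (by fun_prop) hs).2 (ae_of_all _ fun a => ?_)
    simp [g0, c0]

/-- The indicator of the states `(n,x)` with `0 < x ≤ 1/(j+1)`, as a function on `Y × A`. -/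
def shrinkingIndicator (j : ℕ) (z : Y1 × A1) : ℝ :=
  if 0 < (z.1.2 : ℝ) ∧ (z.1.2 : ℝ) ≤ 1 / ((j : ℝ) + 1) then 1 else 0

lemma measurable_shrinkingIndicator (j : ℕ) : Measurable (shrinkingIndicator j) :=
  have hx : Measurable fun z : Y1 × A1 => (z.1.2 : ℝ) := by fun_prop
  Measurable.ite (hx measurableSet_Ioc) measurable_const measurable_const

lemma abs_shrinkingIndicator_le_one (j : ℕ) (z : Y1 × A1) : |shrinkingIndicator j z| ≤ 1 := by
  unfold shrinkingIndicator
  split_ifs <;> simp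

lemma tendsto_shrinkingIndicator (z : Y1 × A1) :
    Tendsto (fun j => shrinkingIndicator j z) atTop (𝓝 0) := by
  refine tendsto_const_nhds.congr' ?_
  rcases z.1.2.2.1.eq_or_lt with h | h
  · exact Eventually.of_forall fun j => by simp [shrinkingIndicator, ← h]
  · filter_upwards [(tendsto_one_div_add_atTop_nhds_zero_nat (𝕜 := ℝ)).eventually_lt_const h]
      with j hj
    exact (if_neg fun hz => hz.2.not_gt hj).symm

lemma tendsto_integral_shrinkingIndicator (L : Measure (Y1 × A1)) [IsFiniteMeasure L] :
    Tendsto (fun j => ∫ z, shrinkingIndicator j z ∂L) atTop (𝓝 0) := by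
  simpa using tendsto_integral_of_dominated_convergence (fun _ => (1 : ℝ))
    (fun j => (measurable_shrinkingIndicator j).aestronglyMeasurable) (integrable_const 1)
    (fun j => ae_of_all L fun z => abs_shrinkingIndicator_le_one j z)
    (ae_of_all L tendsto_shrinkingIndicator)

lemma IsEtaM.integral_shrinkingIndicator {μ : Measure A1} [IsProbabilityMeasure μ] {j m : ℕ}
    (hjm : j ≤ m) {η : Measure (Y1 × A1)} (hη : IsEtaM μ (m + 1) η) :
    ∫ z, shrinkingIndicator j z ∂η = 1 := by
  refine hη.integral_eq_one (by omega) (measurable_shrinkingIndicator j)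
    ⟨1, abs_shrinkingIndicator_le_one j⟩ (fun a => by simp [shrinkingIndicator, c0])
    fun x a h0 h1 => if_pos ⟨h0, h1.trans ?_⟩
  push_cast
  gcongr

/-- `g₀` is a bounded Caratheodory function on `Y × A` with
`∫ g₀ dη_m = 1` for every `m ≥ 1` and `∫ g₀ dη_∞ = 0`; consequently `{η_m}` has no
subsequence converging in `M(Y × A)` in the ws-topology. -/
theorem stmt10
    (μ : Measure A1) [IsProbabilityMeasure μ]
    (ηm : ℕ → Measure (Y1 × A1)) (hηm : ∀ m : ℕ, 1 ≤ m → IsEtaM μ m (ηm m)) :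
    Measurable g0 ∧
      (∃ C, ∀ z, |g0 z| ≤ C) ∧
      (∀ y : Y1, Continuous fun a : A1 => g0 (y, a)) ∧
      (∀ m : ℕ, 1 ≤ m → ∫ z, g0 z ∂(ηm m) = 1) ∧
      (∫ z, g0 z ∂(etaInf μ) = 0) ∧
      ∀ F : ℕ → FiniteMeasure (Y1 × A1),
        (∀ m, (F m : Measure (Y1 × A1)) = ηm (m + 1)) →
        ∀ φ : ℕ → ℕ, StrictMono φ → ∀ L : FiniteMeasure (Y1 × A1),
          ¬ Tendsto (fun k => F (φ k)) atTop (@nhds _ (wsTop Y1 A1) L) := by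
  refine ⟨measurable_g0, ⟨1, abs_g0_le_one⟩,
    fun y => (continuous_const : Continuous fun _ : A1 => g0 (y, c0)), fun m hm => ?_,
    integral_g0_etaInf μ, fun F hF φ hφ L hL => ?_⟩
  · exact (hηm m hm).integral_eq_one hm measurable_g0 ⟨1, abs_g0_le_one⟩
      (fun a => by simp [g0, c0]) fun x a h0 _ => if_pos h0
  · have hone (j : ℕ) : ∫ z, shrinkingIndicator j z ∂(L : Measure (Y1 × A1)) = 1 := by
      refine tendsto_nhds_unique (tendsto_integral_of_tendsto_wsTop hL
        (measurable_shrinkingIndicator j) ⟨1, abs_shrinkingIndicator_le_one j⟩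
        fun y => (continuous_const : Continuous fun _ : A1 => shrinkingIndicator j (y, c0)))
        (tendsto_const_nhds.congr' ?_)
      filter_upwards [eventually_ge_atTop j] with k hk
      rw [hF]
      exact ((hηm _ (by omega)).integral_shrinkingIndicator (hk.trans (hφ.id_le k))).symm
    have hlim := tendsto_integral_shrinkingIndicator (L : Measure (Y1 × A1))
    simp only [hone] at hlim
    exact one_ne_zero (tendsto_nhds_unique tendsto_const_nhds hlim)

end
end
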